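/- Let d ≥ 3. There exists a constant C' > 0, depending only on d and S, such that for every measurable set A = A_∞ × ∏_{p ∈ S_f} A_p ⊆ ℚ_S^d with vol_S(A) > 0 and every admissible measure μ on G_d/Γ_d: μ( {gΓ_d ∈ G_d/Γ_d : g·(ℤ_S^d ∖ {0}) ∩ A = ∅} ) ≤ μ( {gΓ_d ∈ G_d/Γ_d : g·P(ℤ_S^d) ∩ A = ∅} ) ≤ C' / vol_S(A). -/

import Mathlib

open MeasureTheory Matrix ENNReal

noncomputable section

noncomputable instance Padic.instMeasurableSpace' {p : ℕ} [Fact p.Prime] :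
    MeasurableSpace ℚ_[p] := borel _

instance Padic.instBorelSpace' {p : ℕ} [Fact p.Prime] : BorelSpace ℚ_[p] := ⟨rfl⟩

instance Matrix.SpecialLinearGroup.instTopologicalSpace'
    {n : Type*} [DecidableEq n] [Fintype n] {R : Type*} [CommRing R] [TopologicalSpace R] :
    TopologicalSpace (SpecialLinearGroup n R) :=
  show TopologicalSpace {A : Matrix n n R // A.det = 1} from inferInstance

noncomputable instance Matrix.SpecialLinearGroup.instMeasurableSpace'
    {n : Type*} [DecidableEq n] [Fintype n] {R : Type*} [CommRing R] [TopologicalSpace R] :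
    MeasurableSpace (SpecialLinearGroup n R) := borel _

/-- A finite set of distinct primes `p 0, …, p (s-1)`. -/
structure PrimeTup where
  s : ℕ
  p : Fin s → ℕ
  hp : ∀ i, (p i).Prime
  inj : Function.Injective p

namespace PrimeTup

instance (S : PrimeTup) (i : Fin S.s) : Fact (S.p i).Prime := ⟨S.hp i⟩

/-- The `p i`-adic field. -/
abbrev Qp (S : PrimeTup) (i : Fin S.s) : Type := ℚ_[S.p i]

/-- The space `ℚ_S^d = ℝ^d × ∏ᵢ ℚ_{pᵢ}^d`. -/
abbrev QS (S : PrimeTup) (d : ℕ) : Type :=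
  (Fin d → ℝ) × ((i : Fin S.s) → Fin d → S.Qp i)

/-- The ring `ℤ_S = ℤ[1/p₁, …, 1/p_s] ⊆ ℚ`. -/
def Zs (S : PrimeTup) : Subring ℚ :=
  Subring.closure (Set.range fun i : Fin S.s => ((S.p i : ℚ))⁻¹)

/-- The group `G_d = SL_d(ℝ) × ∏ᵢ SL_d(ℚ_{pᵢ})`. -/
abbrev G (S : PrimeTup) (d : ℕ) : Type :=
  SpecialLinearGroup (Fin d) ℝ × ((i : Fin S.s) → SpecialLinearGroup (Fin d) (S.Qp i))

/-- Diagonal embedding of `SL_d(ℤ_S)` into `G_d`. -/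
def toG (S : PrimeTup) (d : ℕ) : SpecialLinearGroup (Fin d) S.Zs →* S.G d :=
  MonoidHom.prod
    (SpecialLinearGroup.map ((Rat.castHom ℝ).comp S.Zs.subtype))
    (Pi.monoidHom fun i => SpecialLinearGroup.map ((Rat.castHom (S.Qp i)).comp S.Zs.subtype))

/-- The lattice `Γ_d`, the diagonally embedded copy of `SL_d(ℤ_S)` in `G_d`. -/
def Gamma (S : PrimeTup) (d : ℕ) : Subgroup (S.G d) := (S.toG d).range

/-- The componentwise linear action of `G_d` on `ℚ_S^d`. -/
def act (S : PrimeTup) {d : ℕ} (g : S.G d) (x : S.QS d) : S.QS d :=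
  ((g.1 : Matrix (Fin d) (Fin d) ℝ).mulVec x.1,
   fun i => ((g.2 i : Matrix (Fin d) (Fin d) (S.Qp i))).mulVec (x.2 i))

/-- Diagonal embedding of rational vectors into `ℚ_S^d`. -/
def diag (S : PrimeTup) {d : ℕ} (v : Fin d → ℚ) : S.QS d :=
  (fun j => (v j : ℝ), fun i j => (v j : S.Qp i))

/-- The first standard basis vector of `ℤ_S^d`. -/
def e1 (S : PrimeTup) (d : ℕ) : Fin d → S.Zs := fun j => if j.1 = 0 then 1 else 0

/-- The set of `S`-primitive vectors `P(ℤ_S^d) = SL_d(ℤ_S)·e₁` inside `(ℤ_S)^d`. -/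
def primZs (S : PrimeTup) (d : ℕ) : Set (Fin d → S.Zs) :=
  {w | ∃ γ : SpecialLinearGroup (Fin d) S.Zs,
    w = (γ : Matrix (Fin d) (Fin d) S.Zs).mulVec (S.e1 d)}

/-- The set of `S`-primitive vectors regarded inside `ℚ_S^d` via the diagonal embedding. -/
def prim (S : PrimeTup) (d : ℕ) : Set (S.QS d) :=
  (fun w : Fin d → S.Zs => S.diag fun j => ((w j : ℚ))) '' S.primZs d

/-- Multiplication of a vector of `ℚ_S^d` by a (diagonally embedded) rational scalar. -/
def ratSMul (S : PrimeTup) {d : ℕ} (q : ℚ) (x : S.QS d) : S.QS d :=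
  (fun j => (q : ℝ) * x.1 j, fun i j => (q : S.Qp i) * x.2 i j)

/-- `ℕ_S`: positive integers coprime to all the primes of `S`. -/
def NS (S : PrimeTup) : Set ℕ := {m | 0 < m ∧ ∀ i, ¬ (S.p i ∣ m)}

/-- The `S`-arithmetic zeta value `ζ_S(d)`. -/
def zetaS (S : PrimeTup) (d : ℕ) : ℝ := ∑' m : S.NS, (1 : ℝ) / ((m : ℕ) : ℝ) ^ d

/-- The "unit box" `[0,1]^d × ∏ᵢ ℤ_{pᵢ}^d` used to normalize the volume on `ℚ_S^d`. -/
def unitBox (S : PrimeTup) (d : ℕ) : Set (S.QS d) :=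
  {x | (∀ j, x.1 j ∈ Set.Icc (0:ℝ) 1) ∧ ∀ i j, ‖x.2 i j‖ ≤ 1}

/-- `v` is the measure `vol_S` on `ℚ_S^d`: the (unique) translation-invariant regular Borel
measure giving the unit box `[0,1]^d × ∏ᵢ ℤ_{pᵢ}^d` measure one; equivalently, the product of
Lebesgue measure on `ℝ^d` and the normalized Haar measures on the `ℚ_{pᵢ}^d`. -/
def IsVolS (S : PrimeTup) (d : ℕ) (v : Measure (S.QS d)) : Prop :=
  v.IsAddHaarMeasure ∧ v.Regular ∧ v (S.unitBox d) = 1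

/-- `μ` is an admissible measure on `G_d/Γ_d`: a regular Borel probability measure invariant
under the left `G_d`-action. -/
def Admissible (S : PrimeTup) (d : ℕ) (μ : Measure (S.G d ⧸ S.Gamma d)) : Prop :=
  IsProbabilityMeasure μ ∧ μ.Regular ∧ SMulInvariantMeasure (S.G d) (S.G d ⧸ S.Gamma d) μ

end PrimeTup

end

section ErgodicTheory

open Filter Set Measure

variable {G Y : Type*} [Group G] [MeasurableSpace G] [MeasurableMul₂ G] [MeasurableInv G]
  [MeasurableSpace Y] [MulAction G Y] [MeasurableSMul₂ G Y]

/-- If the orbit map at one point of a homogeneous set avoids `B` almost surely, then every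
invariant measure carried by the homogeneous set gives `B` measure zero. -/
lemma measure_eq_zero_of_orbit_null (m : Measure G) [SigmaFinite m] [m.IsMulLeftInvariant]
    (hm : m ≠ 0) {O : Set Y} (hO : ∀ x ∈ O, ∀ y ∈ O, ∃ g : G, g • x = y)
    (ν : Measure Y) [SFinite ν] [SMulInvariantMeasure G Y ν] (hν : ν Oᶜ = 0)
    {B : Set Y} (hB : MeasurableSet B) {x₀ : Y} (hx₀ : x₀ ∈ O)
    (h : ∀ᵐ g ∂m, g • x₀ ∉ B) : ν B = 0 := by
  have key : ∀ y ∈ O, ∀ᵐ g ∂m, g • y ∉ B := by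
    intro y hy
    obtain ⟨a, rfl⟩ := hO x₀ hx₀ y hy
    have := (quasiMeasurePreserving_mul_right m a).ae h
    simpa only [mul_smul] using this
  have h1 : ∀ᵐ y ∂ν, ∀ᵐ g ∂m, g • y ∉ B := by
    have : ∀ᵐ y ∂ν, y ∈ O := by rw [ae_iff]; exact hν
    filter_upwards [this] with y hy using key y hy
  rw [ae_ae_comm] at h1
  · have : ∃ g : G, ∀ᵐ y ∂ν, g • y ∉ B := by
      have : (ae m).NeBot := by rwa [ae_neBot]
      exact h1.exists
    obtain ⟨g, hg⟩ := this
    refine (measure_preimage_smul_of_nullMeasurableSet (μ := ν) hB.nullMeasurableSet g).symm.trans ?_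
    rw [ae_iff] at hg
    simp only [not_not] at hg
    exact hg
  · exact (hB.preimage (measurable_snd.smul measurable_fst)).compl

lemma ergodicSMul_of_homogeneous (m : Measure G) [SigmaFinite m] [m.IsMulLeftInvariant]
    (hm : m ≠ 0) {O : Set Y} (hO : ∀ x ∈ O, ∀ y ∈ O, ∃ g : G, g • x = y)
    (ν : Measure Y) [SFinite ν] [SMulInvariantMeasure G Y ν] (hν : ν Oᶜ = 0) :
    ErgodicSMul G Y ν := by
  refine ⟨fun {s} hsm hs ↦ ?_⟩
  suffices (∃ᵐ x ∂ν, x ∈ s) → ∀ᵐ x ∂ν, x ∈ s by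
    simp only [eventuallyConst_set, ← not_frequently]
    exact or_not_of_imp this
  intro hνs
  have hmem : ∀ᵐ y ∂ν, y ∈ O := by rw [ae_iff]; exact hν
  obtain ⟨a, has, haO, ha⟩ : ∃ a ∈ s, a ∈ O ∧ ∀ᵐ b ∂m, (b • a ∈ s ↔ a ∈ s) := by
    refine (hνs.and_eventually (hmem.and ?_)).exists
    rw [ae_ae_comm]
    · exact ae_of_all _ fun b ↦ (hs b).mem_iff
    · exact ((hsm.preimage <| measurable_snd.smul measurable_fst).mem.iff
        (hsm.preimage measurable_fst).mem).setOf
  rw [ae_iff]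
  exact measure_eq_zero_of_orbit_null m hm hO ν hν (B := sᶜ) hsm.compl haO
    (by filter_upwards [ha] with b hb; simpa [hb] using has)

/-- Uniqueness of the invariant measure carried by a homogeneous set. -/
lemma exists_eq_smul_of_homogeneous (m : Measure G) [SigmaFinite m] [m.IsMulLeftInvariant]
    (hm : m ≠ 0) {O : Set Y} (hO : ∀ x ∈ O, ∀ y ∈ O, ∃ g : G, g • x = y)
    (ν l : Measure Y) [SigmaFinite ν] [SigmaFinite l] [SMulInvariantMeasure G Y ν]
    [SMulInvariantMeasure G Y l] (hν : ν Oᶜ = 0) (hl : l Oᶜ = 0) (hl0 : l ≠ 0) :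
    ∃ c : ℝ≥0∞, c ≠ ∞ ∧ ν = c • l := by
  have : (ae l).NeBot := by rwa [ae_neBot]
  have hmem : ∀ᵐ y ∂l, y ∈ O := by rw [ae_iff]; exact hl
  have hac : ν ≪ l := by
    refine AbsolutelyContinuous.mk fun B hB hlB ↦ ?_
    obtain ⟨a, haO, ha⟩ : ∃ a ∈ O, ∀ᵐ b ∂m, b • a ∉ B := by
      refine (hmem.and ?_).exists
      rw [ae_ae_comm]
      · refine ae_of_all _ fun b ↦ ?_
        rw [ae_iff]
        simp only [not_not]
        exact (measure_preimage_smul_of_nullMeasurableSet (μ := l) hB.nullMeasurableSet b).trans hlB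
      · exact (hB.preimage (measurable_snd.smul measurable_fst)).compl
    exact measure_eq_zero_of_orbit_null m hm hO ν hν hB haO ha
  have herg := ergodicSMul_of_homogeneous m hm hO l hl
  have hinv : ∀ g : G, (fun y ↦ ν.rnDeriv l (g • y)) =ᵐ[l] ν.rnDeriv l := by
    intro g
    have := (measurableEmbedding_const_smul g).rnDeriv_map ν l
    rwa [(measurePreserving_smul g ν).map_eq, (measurePreserving_smul g l).map_eq] at this
  obtain ⟨c, hc⟩ : ∃ c, ν.rnDeriv l =ᶠ[ae l] Function.const Y c := by
    refine exists_eventuallyEq_const_of_forall_separating MeasurableSet fun U hU ↦ ?_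
    have := aeconst_of_forall_preimage_smul_ae_eq G (μ := l) (s := ν.rnDeriv l ⁻¹' U)
      ((measurable_rnDeriv ν l) hU).nullMeasurableSet fun g ↦ by
        filter_upwards [hinv g] with y hy
        change (ν.rnDeriv l (g • y) ∈ U) = (ν.rnDeriv l y ∈ U)
        rw [hy]
    rw [eventuallyConst_set] at this
    exact this
  refine ⟨c, ?_, ?_⟩
  · obtain ⟨y, hy, hy'⟩ := (hc.and (rnDeriv_lt_top ν l)).exists
    simpa [hy] using hy'.ne
  · rw [← withDensity_rnDeriv_eq ν l hac, withDensity_congr_ae hc]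
    exact withDensity_const c

end ErgodicTheory

section SiegelTransform

open Measure Function

variable {G Y : Type*} [Group G] [MulAction G Y] {Γ : Subgroup G}

/-- The sum of `f` over the translate of the set `T` by a representative of a coset. -/
noncomputable def siegelSum (Γ : Subgroup G) (T : Set Y) (f : Y → ℝ≥0∞) (x : G ⧸ Γ) : ℝ≥0∞ :=
  ∑' t : T, f (x.out • (t : Y))

lemma siegelSum_mk {T : Set Y} (hT : ∀ γ ∈ Γ, ∀ t ∈ T, γ • t ∈ T) (f : Y → ℝ≥0∞) (g : G) :
    siegelSum Γ T f (g : G ⧸ Γ) = ∑' t : T, f (g • (t : Y)) := by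
  obtain ⟨⟨γ, hγ⟩, h⟩ := QuotientGroup.mk_out_eq_mul Γ g
  unfold siegelSum
  rw [h]
  let e : T ≃ T :=
    { toFun := fun t ↦ ⟨γ • (t : Y), hT γ hγ t t.2⟩
      invFun := fun t ↦ ⟨γ⁻¹ • (t : Y), hT _ (inv_mem hγ) t t.2⟩
      left_inv := fun t ↦ by simp
      right_inv := fun t ↦ by simp }
  rw [← e.tsum_eq (fun t : T ↦ f (g • (t : Y)))]
  simp [e, mul_smul]

lemma siegelSum_smul (hT : ∀ γ ∈ Γ, ∀ t ∈ T, γ • t ∈ T) (f : Y → ℝ≥0∞) (g : G) (x : G ⧸ Γ) :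
    siegelSum Γ T f (g • x) = siegelSum Γ T (fun y ↦ f (g • y)) x := by
  induction x using QuotientGroup.induction_on with | _ h
  change siegelSum Γ T f ((g * h : G) : G ⧸ Γ) = _
  rw [siegelSum_mk hT, siegelSum_mk hT]
  simp [mul_smul]

variable [MeasurableSpace G] [MeasurableSpace Y]

section

variable [MeasurableSMul G Y] {T : Set Y}

lemma measurable_siegelSum [Countable T] (hT : ∀ γ ∈ Γ, ∀ t ∈ T, γ • t ∈ T)
    {f : Y → ℝ≥0∞} (hf : Measurable f) : Measurable (siegelSum Γ T f) := by
  rw [QuotientGroup.measurable_from_quotient]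
  have : siegelSum Γ T f ∘ (QuotientGroup.mk : G → G ⧸ Γ) =
      fun g ↦ ∑' t : T, f (g • (t : Y)) := by
    funext g
    exact siegelSum_mk hT f g
  rw [this]
  exact Measurable.tsum fun t ↦ hf.comp (measurable_smul_const _)

/-- The mean of the counting measures of the translates of `T`. -/
noncomputable def siegelMeasure (T : Set Y) (μ : Measure (G ⧸ Γ)) : Measure Y :=
  μ.bind fun x ↦ sum fun t : T ↦ dirac (x.out • (t : Y))

lemma measurable_siegelKernel [Countable T] (hT : ∀ γ ∈ Γ, ∀ t ∈ T, γ • t ∈ T) :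
    Measurable fun x : G ⧸ Γ ↦ (sum fun t : T ↦ dirac (x.out • (t : Y)) : Measure Y) := by
  refine measurable_of_measurable_coe _ fun s hs ↦ ?_
  have := measurable_siegelSum (Γ := Γ) hT (measurable_const.indicator hs : Measurable
    (s.indicator fun _ ↦ (1 : ℝ≥0∞)))
  convert this using 2 with x
  simp [siegelSum, sum_apply _ hs, dirac_apply' _ hs]
  rfl

lemma lintegral_siegelMeasure [Countable T] (hT : ∀ γ ∈ Γ, ∀ t ∈ T, γ • t ∈ T)
    (μ : Measure (G ⧸ Γ)) {f : Y → ℝ≥0∞} (hf : Measurable f) :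
    ∫⁻ y, f y ∂(siegelMeasure T μ) = ∫⁻ x, siegelSum Γ T f x ∂μ := by
  rw [siegelMeasure, lintegral_bind (measurable_siegelKernel hT).aemeasurable hf.aemeasurable]
  refine lintegral_congr fun x ↦ ?_
  rw [lintegral_sum_measure]
  simp [siegelSum, lintegral_dirac' _ hf]

lemma siegelMeasure_apply [Countable T] (hT : ∀ γ ∈ Γ, ∀ t ∈ T, γ • t ∈ T)
    (μ : Measure (G ⧸ Γ)) {s : Set Y} (hs : MeasurableSet s) :
    siegelMeasure T μ s = ∫⁻ x, siegelSum Γ T (s.indicator 1) x ∂μ := by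
  rw [← lintegral_siegelMeasure hT μ (measurable_one.indicator hs), lintegral_indicator_one hs]

lemma siegelMeasure_eq_zero [Countable T] (hT : ∀ γ ∈ Γ, ∀ t ∈ T, γ • t ∈ T)
    (μ : Measure (G ⧸ Γ)) {s : Set Y} (hs : MeasurableSet s)
    (h : ∀ g : G, ∀ t ∈ T, g • t ∉ s) : siegelMeasure T μ s = 0 := by
  rw [siegelMeasure_apply hT μ hs]
  simp only [siegelSum, Set.indicator_of_notMem (h _ _ (Subtype.coe_prop _)), tsum_zero,
    lintegral_zero]

variable [MeasurableMul G]

instance : MeasurableConstSMul G (G ⧸ Γ) := by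
  refine ⟨fun g ↦ ?_⟩
  rw [QuotientGroup.measurable_from_quotient]
  exact QuotientGroup.measurable_coe.comp (measurable_const_mul g)

lemma smulInvariantMeasure_siegelMeasure [Countable T] (hT : ∀ γ ∈ Γ, ∀ t ∈ T, γ • t ∈ T)
    (μ : Measure (G ⧸ Γ)) [SMulInvariantMeasure G (G ⧸ Γ) μ] :
    SMulInvariantMeasure G Y (siegelMeasure T μ) := by
  refine ⟨fun g s hs ↦ ?_⟩
  rw [siegelMeasure_apply hT μ hs, siegelMeasure_apply hT μ (hs.preimage (measurable_const_smul g)),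
    ← (measurePreserving_smul g μ).lintegral_comp
      (measurable_siegelSum hT (measurable_one.indicator hs))]
  refine lintegral_congr fun x ↦ ?_
  rw [siegelSum_smul hT]
  rfl

end

end SiegelTransform

section Variance

open Filter Measure

/-- The closed convex hull of an orbit of a group of isometries contains a fixed point. -/
lemma exists_fixed_mem_closure_convexHull {H : Type*} [NormedAddCommGroup H]
    [InnerProductSpace ℝ H] [CompleteSpace H] {G : Type*} (U : G → H →ₗᵢ[ℝ] H) (K₀ : Set H)
    (hne : K₀.Nonempty) (hU : ∀ g, ∀ x ∈ K₀, U g x ∈ K₀) :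
    ∃ u ∈ closure (convexHull ℝ K₀), ∀ g, U g u = u := by
  set K := closure (convexHull ℝ K₀) with hK
  have hconv : Convex ℝ K := (convex_convexHull ℝ K₀).closure
  have hKne : K.Nonempty := (hne.mono (subset_convexHull ℝ K₀)).closure
  have hUK : ∀ g, ∀ x ∈ K, U g x ∈ K := by
    intro g x hx
    have h1 : convexHull ℝ K₀ ⊆ (U g : H → H) ⁻¹' convexHull ℝ K₀ := by
      refine convexHull_min (fun y hy ↦ subset_convexHull ℝ K₀ (hU g y hy)) ?_
      exact (convex_convexHull ℝ K₀).linear_preimage (U g).toLinearMap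
    exact map_mem_closure (U g).continuous hx h1
  obtain ⟨u, huK, hu⟩ := exists_norm_eq_iInf_of_complete_convex hKne
    isClosed_closure.isComplete hconv (0 : H)
  refine ⟨u, huK, fun g ↦ ?_⟩
  have h := (norm_eq_iInf_iff_real_inner_le_zero hconv huK).1 hu (U g u) (hUK g u huK)
  rw [zero_sub, inner_neg_left, inner_sub_right, real_inner_self_eq_norm_sq] at h
  have h2 : ‖U g u - u‖ ^ 2 = ‖u‖ ^ 2 - 2 * inner ℝ u (U g u) + ‖u‖ ^ 2 := by
    rw [norm_sub_sq_real, (U g).norm_map, real_inner_comm]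
  have h3 : ‖U g u - u‖ ^ 2 ≤ 0 := by rw [h2]; linarith
  have h4 : ‖U g u - u‖ = 0 := by
    have := sq_nonneg ‖U g u - u‖
    exact pow_eq_zero_iff (two_ne_zero) |>.1 (le_antisymm h3 this)
  exact sub_eq_zero.1 (norm_eq_zero.1 h4)

variable {G X : Type*} [Group G] [MulAction G X] [MeasurableSpace X] [MeasurableConstSMul G X]
  {μ : Measure X} [IsProbabilityMeasure μ] [ErgodicSMul G X μ]

lemma integral_sq_le_of_forall_smul {φ : X → ℝ} (hφ : MemLp φ 2 μ) {ε : ℝ}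
    (h : ∀ g : G, ∫ x, φ x ^ 2 ∂μ ≤ ∫ x, φ x * φ (g • x) ∂μ + ε) :
    ∫ x, φ x ^ 2 ∂μ ≤ (∫ x, φ x ∂μ) ^ 2 + ε := by
  let U : G → Lp ℝ 2 μ →ₗᵢ[ℝ] Lp ℝ 2 μ := fun g ↦
    Lp.compMeasurePreservingₗᵢ ℝ (g • ·) (measurePreserving_smul g μ)
  let v : Lp ℝ 2 μ := hφ.toLp φ
  have hv : v =ᵐ[μ] φ := hφ.coeFn_toLp
  have hUc : ∀ g (w : Lp ℝ 2 μ), U g w =ᵐ[μ] fun x ↦ w (g • x) := fun g w ↦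
    Lp.coeFn_compMeasurePreserving w (measurePreserving_smul g μ)
  have hUv : ∀ g, U g v =ᵐ[μ] fun x ↦ φ (g • x) := fun g ↦
    (hUc g v).trans ((measurePreserving_smul g μ).quasiMeasurePreserving.ae_eq_comp hv)
  have hone : MemLp (fun _ : X ↦ (1 : ℝ)) 2 μ := memLp_const 1
  let e : Lp ℝ 2 μ := hone.toLp _
  have he : e =ᵐ[μ] fun _ ↦ (1 : ℝ) := hone.coeFn_toLp
  have hinner : ∀ w z : Lp ℝ 2 μ, inner ℝ w z = ∫ x, w x * z x ∂μ := by
    intro w z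
    rw [L2.inner_def]
    refine integral_congr_ae (ae_of_all _ fun x ↦ ?_)
    simp [mul_comm]
  obtain ⟨u, huK, hu⟩ := exists_fixed_mem_closure_convexHull U (Set.range fun g ↦ U g v)
    ⟨_, 1, rfl⟩ (by
      rintro g _ ⟨k, rfl⟩
      refine ⟨k * g, ?_⟩
      apply Lp.ext
      filter_upwards [hUv (k * g), hUc g (U k v),
        (measurePreserving_smul g μ).quasiMeasurePreserving.ae_eq_comp (hUv k)] with x h1 h2 h3
      rw [h1, h2]
      simp only [Function.comp] at h3
      rw [h3, mul_smul])
  have hcl : ∀ (w : Lp ℝ 2 μ) (a : ℝ), (∀ g, a ≤ inner ℝ w (U g v)) → a ≤ inner ℝ w u := by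
    intro w a hw
    have hc : IsClosed {z : Lp ℝ 2 μ | a ≤ inner ℝ w z} :=
      isClosed_le continuous_const (continuous_const.inner continuous_id)
    have hcv : Convex ℝ {z : Lp ℝ 2 μ | a ≤ inner ℝ w z} :=
      convex_halfSpace_ge (f := fun z ↦ inner ℝ w z)
        ⟨fun x y ↦ inner_add_right _ _ _, fun c x ↦ by simp [inner_smul_right]⟩ a
    exact closure_minimal (convexHull_min (by rintro _ ⟨g, rfl⟩; exact hw g) hcv) hc huK
  have heU : ∀ g, inner ℝ e (U g v) = ∫ x, φ x ∂μ := by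
    intro g
    rw [hinner, ← (measurePreserving_smul g μ).integral_comp (measurableEmbedding_const_smul g) φ]
    refine integral_congr_ae ?_
    filter_upwards [he, hUv g] with x h1 h2
    rw [h1, h2, one_mul]
  have heu : inner ℝ e u = ∫ x, φ x ∂μ := by
    refine le_antisymm ?_ (hcl e _ fun g ↦ (heU g).ge)
    have := hcl (-e) (-∫ x, φ x ∂μ) fun g ↦ by rw [inner_neg_left, heU]
    rw [inner_neg_left] at this
    linarith
  obtain ⟨c, hc⟩ : ∃ c, (u : X → ℝ) =ᶠ[ae μ] Function.const X c := by
    refine exists_eventuallyEq_const_of_forall_separating MeasurableSet fun W hW ↦ ?_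
    have := aeconst_of_forall_preimage_smul_ae_eq G (μ := μ) (s := (u : X → ℝ) ⁻¹' W)
      (((Lp.stronglyMeasurable u).measurable hW).nullMeasurableSet) fun g ↦ by
        filter_upwards [hUc g u] with y hy
        change ((u : X → ℝ) (g • y) ∈ W) = ((u : X → ℝ) y ∈ W)
        rw [← hy, hu g]
    rw [eventuallyConst_set] at this
    exact this
  have hcval : c = ∫ x, φ x ∂μ := by
    rw [← heu, hinner, integral_congr_ae (g := fun _ ↦ c)]
    · simp
    · filter_upwards [he, hc] with x h1 h2
      rw [h1, h2, one_mul]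
      rfl
  have h1 : ∫ x, φ x ^ 2 ∂μ - ε ≤ inner ℝ v u := by
    refine hcl v _ fun g ↦ ?_
    have : inner ℝ v (U g v) = ∫ x, φ x * φ (g • x) ∂μ := by
      rw [hinner]
      refine integral_congr_ae ?_
      filter_upwards [hv, hUv g] with x h1 h2
      rw [h1, h2]
    rw [this]
    linarith [h g]
  have h2 : inner ℝ v u = (∫ x, φ x ∂μ) ^ 2 := by
    rw [hinner, integral_congr_ae (g := fun x ↦ φ x * c), integral_mul_const, hcval, sq]
    filter_upwards [hv, hc] with x h1 h2
    rw [h1, h2]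
    rfl
  linarith

/-- An almost invariant square-integrable function on an ergodic space rarely vanishes. -/
lemma measure_eq_zero_mul_sq_le {ψ : X → ℝ≥0∞} (hψ : Measurable ψ)
    (h2 : ∫⁻ x, ψ x ^ 2 ∂μ ≠ ∞) {ε : ℝ≥0∞} (hε : ε ≠ ∞)
    (h : ∀ g : G, ∫⁻ x, ψ x ^ 2 ∂μ ≤ ∫⁻ x, ψ x * ψ (g • x) ∂μ + ε) :
    μ {x | ψ x = 0} * (∫⁻ x, ψ x ∂μ) ^ 2 ≤ ε := by
  have hfin : ∀ᵐ x ∂μ, ψ x < ∞ := by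
    filter_upwards [ae_lt_top (hψ.pow_const 2) h2] with x hx
    simpa using hx
  set φ : X → ℝ := fun x ↦ (ψ x).toReal with hφdef
  have hφm : Measurable φ := hψ.ennreal_toReal
  have hφψ : ∀ᵐ x ∂μ, ENNReal.ofReal (φ x) = ψ x := by
    filter_upwards [hfin] with x hx using ofReal_toReal hx.ne
  have hmem : MemLp φ 2 μ := by
    rw [memLp_two_iff_integrable_sq hφm.aestronglyMeasurable]
    refine ⟨(hφm.pow_const 2).aestronglyMeasurable, ?_⟩
    rw [hasFiniteIntegral_iff_ofReal (ae_of_all _ fun x ↦ sq_nonneg _)]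
    rw [lintegral_congr_ae (g := fun x ↦ ψ x ^ 2)]
    · exact h2.lt_top
    · filter_upwards [hφψ] with x hx
      rw [ENNReal.ofReal_pow toReal_nonneg, hx]
  have hI2 : ∫ x, φ x ^ 2 ∂μ = (∫⁻ x, ψ x ^ 2 ∂μ).toReal := by
    rw [integral_eq_lintegral_of_nonneg_ae (ae_of_all _ fun x ↦ sq_nonneg _)
      (hφm.pow_const 2).aestronglyMeasurable]
    congr 1
    refine lintegral_congr_ae ?_
    filter_upwards [hφψ] with x hx
    rw [ENNReal.ofReal_pow toReal_nonneg, hx]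
  have hI1 : ∫ x, φ x ∂μ = (∫⁻ x, ψ x ∂μ).toReal := by
    rw [integral_eq_lintegral_of_nonneg_ae (ae_of_all _ fun x ↦ toReal_nonneg)
      hφm.aestronglyMeasurable]
    congr 1
    exact lintegral_congr_ae hφψ
  have hint : Integrable φ μ := hmem.integrable one_le_two
  have h1 : ∫⁻ x, ψ x ∂μ ≠ ∞ := by
    rw [← lintegral_congr_ae hφψ]
    exact (hasFiniteIntegral_iff_ofReal (ae_of_all _ fun x ↦ toReal_nonneg)).1 hint.2 |>.ne
  have hmain : ∫ x, φ x ^ 2 ∂μ ≤ (∫ x, φ x ∂μ) ^ 2 + ε.toReal := by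
    refine integral_sq_le_of_forall_smul (G := G) hmem fun g ↦ ?_
    have hmg : Measurable fun x : X ↦ φ (g • x) := hφm.comp (measurable_const_smul g)
    have hmemg : MemLp (fun x ↦ φ (g • x)) 2 μ :=
      hmem.comp_measurePreserving (measurePreserving_smul g μ)
    have hintg : Integrable (fun x ↦ φ x * φ (g • x)) μ := hmem.integrable_mul hmemg
    have hnn : 0 ≤ᵐ[μ] fun x ↦ φ x * φ (g • x) :=
      ae_of_all _ fun x ↦ mul_nonneg toReal_nonneg toReal_nonneg
    have hcongr : ∀ᵐ x ∂μ, ENNReal.ofReal (φ x * φ (g • x)) = ψ x * ψ (g • x) := by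
      filter_upwards [hφψ, (measurePreserving_smul g μ).quasiMeasurePreserving.ae hφψ] with x h1 h2
      rw [ENNReal.ofReal_mul toReal_nonneg, h1, h2]
    have hIg : ∫ x, φ x * φ (g • x) ∂μ = (∫⁻ x, ψ x * ψ (g • x) ∂μ).toReal := by
      rw [integral_eq_lintegral_of_nonneg_ae hnn (hφm.mul hmg).aestronglyMeasurable]
      congr 1
      exact lintegral_congr_ae hcongr
    have hfing : ∫⁻ x, ψ x * ψ (g • x) ∂μ ≠ ∞ := by
      rw [← lintegral_congr_ae hcongr]
      exact ((hasFiniteIntegral_iff_ofReal hnn).1 hintg.2).ne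
    rw [hI2, hIg, ← toReal_add hfing hε]
    exact toReal_mono (add_ne_top.2 ⟨hfing, hε⟩) (h g)
  set c := ∫ x, φ x ∂μ with hc
  have hs : MeasurableSet {x | ψ x = 0} := hψ (measurableSet_singleton 0)
  have hcheb : μ.real {x | ψ x = 0} * c ^ 2 ≤ ε.toReal := by
    have hi : Integrable (fun x ↦ (φ x - c) ^ 2) μ :=
      ((memLp_two_iff_integrable_sq (hφm.sub_const c).aestronglyMeasurable).1
        (hmem.sub (memLp_const c)))
    have hv : ∫ x, (φ x - c) ^ 2 ∂μ = ∫ x, φ x ^ 2 ∂μ - c ^ 2 := by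
      have : ∀ x, (φ x - c) ^ 2 = φ x ^ 2 - (2 * c) * φ x + c ^ 2 := fun x ↦ by ring
      simp_rw [this]
      rw [integral_add (f := fun x ↦ φ x ^ 2 - 2 * c * φ x)
          ((hmem.integrable_sq).sub (hint.const_mul _)) (integrable_const _),
        integral_sub hmem.integrable_sq (hint.const_mul _), integral_const_mul, ← hc]
      simp
      ring
    have hset : ∫ x in {x | ψ x = 0}, (φ x - c) ^ 2 ∂μ = μ.real {x | ψ x = 0} * c ^ 2 := by
      rw [setIntegral_congr_fun (g := fun _ ↦ c ^ 2) hs, setIntegral_const, smul_eq_mul]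
      intro x hx
      have hx : ψ x = 0 := hx
      simp [hφdef, hx]
    have := setIntegral_le_integral (s := {x | ψ x = 0}) hi (ae_of_all _ fun x ↦ sq_nonneg _)
    linarith
  rw [← ENNReal.toReal_le_toReal (mul_ne_top (measure_ne_top _ _) (pow_ne_top h1)) hε]
  rw [toReal_mul, toReal_pow, ← hI1]
  exact hcheb

end Variance

section SiegelFiniteness

open Measure

lemma ENNReal.tsum_le_tsum_of_lift {α β : Type*} (F : α → ℝ≥0∞) (H : β → ℝ≥0∞) (π : β → α)
    (h : ∀ a, F a ≠ 0 → ∃ b, π b = a ∧ F a ≤ H b) : ∑' a, F a ≤ ∑' b, H b := by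
  rw [← ENNReal.tsum_fiberwise H π]
  refine ENNReal.tsum_le_tsum fun a ↦ ?_
  by_cases ha : F a = 0
  · simp [ha]
  · obtain ⟨b, hb, hab⟩ := h a ha
    exact hab.trans (ENNReal.le_tsum (f := fun b : π ⁻¹' {a} ↦ H b) ⟨b, hb⟩)

variable {G Y Z : Type*} [Group G] [MulAction G Y] [MulAction G Z] {Γ : Subgroup G}
  [MeasurableSpace G] [MeasurableSpace Y] [MeasurableSpace Z] [MeasurableSMul G Y]
  [MeasurableSMul G Z]

lemma siegelMeasure_le_of_lift {T : Set Y} {T' : Set Z} [Countable T] [Countable T']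
    (hT : ∀ γ ∈ Γ, ∀ t ∈ T, γ • t ∈ T) (hT' : ∀ γ ∈ Γ, ∀ t ∈ T', γ • t ∈ T')
    (μ : Measure (G ⧸ Γ)) {U : Set Y} {U' : Set Z} (hU : MeasurableSet U)
    (hU' : MeasurableSet U') (π : Z → Y)
    (h : ∀ g : G, ∀ t ∈ T, g • t ∈ U → ∃ t' ∈ T', π t' = t ∧ g • t' ∈ U') :
    siegelMeasure T μ U ≤ siegelMeasure T' μ U' := by
  rw [siegelMeasure_apply hT μ hU, siegelMeasure_apply hT' μ hU']
  refine lintegral_mono fun x ↦ ?_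
  unfold siegelSum
  rw [tsum_subtype T (fun t ↦ U.indicator 1 (x.out • t)),
    tsum_subtype T' (fun t ↦ U'.indicator 1 (x.out • t))]
  refine ENNReal.tsum_le_tsum_of_lift _ _ π fun t ht ↦ ?_
  have ht1 : t ∈ T := by
    by_contra hc
    simp [hc] at ht
  have ht2 : x.out • t ∈ U := by
    by_contra hc
    simp [hc, ht1] at ht
  obtain ⟨t', h1, h2, h3⟩ := h _ t ht1 ht2
  exact ⟨t', h2, by simp [ht1, ht2, h1, h3]⟩

lemma siegelMeasure_ne_top_of_finite {T : Set Y} [Countable T]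
    (hT : ∀ γ ∈ Γ, ∀ t ∈ T, γ • t ∈ T) (μ : Measure (G ⧸ Γ)) [IsFiniteMeasure μ] {U : Set Y}
    (hU : MeasurableSet U) {ι : Type*} [Finite ι] (φ : ι → Y → Y)
    (h : ∀ g : G, ∀ t ∈ T, g • t ∈ U → ∀ t' ∈ T, g • t' ∈ U → ∃ i, t' = φ i t) :
    siegelMeasure T μ U ≠ ∞ := by
  have : siegelMeasure T μ U ≤ ∫⁻ _, (∑' _ : ι, 1 : ℝ≥0∞) ∂μ := by
    rw [siegelMeasure_apply hT μ hU]
    refine lintegral_mono fun x ↦ ?_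
    unfold siegelSum
    rw [tsum_subtype T (fun t ↦ U.indicator 1 (x.out • t))]
    by_cases hx : ∃ t ∈ T, x.out • t ∈ U
    · obtain ⟨t₀, ht₀, hU₀⟩ := hx
      refine ENNReal.tsum_le_tsum_of_lift _ _ (fun i ↦ φ i t₀) fun t ht ↦ ?_
      have ht1 : t ∈ T := by
        by_contra hc
        simp [hc] at ht
      have ht2 : x.out • t ∈ U := by
        by_contra hc
        simp [hc, ht1] at ht
      obtain ⟨i, hi⟩ := h _ t₀ ht₀ hU₀ t ht1 ht2
      exact ⟨i, hi.symm, by simp [ht1, ht2]⟩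
    · push Not at hx
      rw [ENNReal.tsum_eq_zero.2 fun t ↦ ?_]
      · exact zero_le
      · by_cases ht : t ∈ T
        · simp [ht, hx t ht]
        · simp [ht]
  refine (this.trans_lt ?_).ne
  rw [lintegral_const]
  refine mul_lt_top ?_ (measure_lt_top _ _)
  have := Fintype.ofFinite ι
  simp

/-- An invariant measure carried by an orbit and finite on a neighbourhood of a point is
σ-finite. -/
lemma sigmaFinite_of_nhds [TopologicalSpace G] [IsTopologicalGroup G]
    [SecondCountableTopology G] (ν : Measure Y) [SMulInvariantMeasure G Y ν] (e : Y)
    (hν : ν (Set.range fun g : G ↦ g • e)ᶜ = 0) {W : Set G} (hW : W ∈ nhds 1) {U : Set Y}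
    (hU : MeasurableSet U) (hWU : ∀ g ∈ W, g • e ∈ U) (hfin : ν U ≠ ∞) : SigmaFinite ν := by
  obtain ⟨s, hs, hcov⟩ := TopologicalSpace.countable_cover_nhds (α := G)
    (f := fun x ↦ (fun y ↦ x⁻¹ * y) ⁻¹' W) (fun x ↦ by
      apply (continuous_const_mul x⁻¹).continuousAt
      simpa using hW)
  have : Countable s := hs
  let A : Option s → Set Y := fun o ↦ match o with
    | none => (⋃ x : s, (fun y ↦ (x : G)⁻¹ • y) ⁻¹' U)ᶜ
    | some x => (fun y ↦ (x : G)⁻¹ • y) ⁻¹' U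
  have hA : ∀ o, ν (A o) < ∞ := by
    intro o
    match o with
    | none =>
      refine lt_of_le_of_lt (measure_mono ?_) (hν.trans_lt zero_lt_top)
      refine Set.compl_subset_compl.2 ?_
      rintro _ ⟨g, rfl⟩
      have : g ∈ ⋃ x ∈ s, (fun y ↦ x⁻¹ * y) ⁻¹' W := by rw [hcov]; trivial
      simp only [Set.mem_iUnion] at this
      obtain ⟨x, hx, hg⟩ := this
      refine Set.mem_iUnion.2 ⟨⟨x, hx⟩, ?_⟩
      have := hWU _ hg
      rw [mul_smul] at this
      exact this
    | some x =>
      refine lt_of_eq_of_lt ?_ hfin.lt_top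
      exact measure_preimage_smul_of_nullMeasurableSet hU.nullMeasurableSet _
  obtain ⟨enc, henc⟩ := exists_surjective_nat (Option s)
  refine SigmaFinite.mk ⟨?_⟩
  refine ⟨fun n ↦ A (enc n), fun _ ↦ trivial, fun n ↦ hA _, ?_⟩
  refine Set.eq_univ_of_forall fun y ↦ ?_
  by_cases hy : y ∈ ⋃ x : s, (fun y ↦ (x : G)⁻¹ • y) ⁻¹' U
  · obtain ⟨x, hx⟩ := Set.mem_iUnion.1 hy
    obtain ⟨n, hn⟩ := henc (some x)
    exact Set.mem_iUnion.2 ⟨n, by rw [hn]; exact hx⟩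
  · obtain ⟨n, hn⟩ := henc none
    exact Set.mem_iUnion.2 ⟨n, by rw [hn]; exact hy⟩

end SiegelFiniteness

section ErgodicQuotient

open Measure Filter

variable {G : Type*} [Group G] {Γ : Subgroup G} [MeasurableSpace G] [MeasurableMul₂ G]
  [MeasurableInv G]

lemma ergodicSMul_quotient [Countable Γ] (μ : Measure (G ⧸ Γ))
    [SMulInvariantMeasure G (G ⧸ Γ) μ] [SigmaFinite (siegelMeasure (Γ : Set G) μ)] :
    ErgodicSMul G (G ⧸ Γ) μ := by
  have hT : ∀ γ ∈ Γ, ∀ t ∈ (Γ : Set G), (γ : G) • (t : G) ∈ (Γ : Set G) := fun γ hγ t ht ↦ mul_mem hγ ht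
  have : Countable (Γ : Set G) := ‹Countable Γ›
  set ν := siegelMeasure (Γ : Set G) μ
  have hinv := smulInvariantMeasure_siegelMeasure hT μ (Γ := Γ)
  have : ν.IsMulLeftInvariant := ⟨fun g ↦ (MeasureTheory.map_smul (μ := ν) g : _)⟩
  have hnull : ∀ F : Set (G ⧸ Γ), MeasurableSet F →
      (ν (QuotientGroup.mk ⁻¹' F) = 0 ↔ μ F = 0) := by
    intro F hF
    have hF' : MeasurableSet (QuotientGroup.mk ⁻¹' F : Set G) :=
      hF.preimage QuotientGroup.measurable_coe
    have hsum : ∀ x, siegelSum Γ (Γ : Set G) ((QuotientGroup.mk ⁻¹' F : Set G).indicator 1) x =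
        ∑' _ : (Γ : Set G), F.indicator 1 x := by
      intro x
      refine tsum_congr fun t ↦ ?_
      have : ((x.out * (t : G) : G) : G ⧸ Γ) = x := by
        rw [QuotientGroup.mk_mul_of_mem _ t.2]
        exact Quotient.out_eq' x
      by_cases hx : x ∈ F <;> simp [Set.indicator, this, hx]
    rw [siegelMeasure_apply hT μ hF', lintegral_congr hsum]
    have hm : Measurable fun x ↦ ∑' _ : (Γ : Set G), F.indicator (1 : G ⧸ Γ → ℝ≥0∞) x :=
      Measurable.tsum fun _ ↦ measurable_one.indicator hF
    rw [lintegral_eq_zero_iff hm, ← lintegral_indicator_one hF,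
      lintegral_eq_zero_iff (measurable_one.indicator hF)]
    refine eventually_congr (Eventually.of_forall fun x ↦ ?_)
    simp only [Pi.zero_apply, ENNReal.tsum_eq_zero]
    exact ⟨fun h ↦ h ⟨1, one_mem Γ⟩, fun h _ ↦ h⟩
  refine ⟨fun {s} hs h ↦ ?_⟩
  have hae := aeconst_of_forall_preimage_smul_ae_eq G (μ := ν)
    (s := (QuotientGroup.mk ⁻¹' s : Set G))
    (hs.preimage QuotientGroup.measurable_coe).nullMeasurableSet fun g ↦ by
      have h1 := h g
      rw [ae_eq_set] at h1 ⊢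
      exact ⟨(hnull _ ((hs.preimage (measurable_const_smul g)).diff hs)).2 h1.1,
        (hnull _ (hs.diff (hs.preimage (measurable_const_smul g)))).2 h1.2⟩
  rw [eventuallyConst_set] at hae ⊢
  rcases hae with hae | hae
  · left
    rw [ae_iff] at hae ⊢
    exact (hnull _ hs.compl).1 hae
  · right
    rw [ae_iff] at hae ⊢
    simp only [not_not] at hae ⊢
    exact (hnull _ hs).1 hae

end ErgodicQuotient

namespace Matrix.SpecialLinearGroup

variable {n : Type*} [DecidableEq n] [Fintype n] {R : Type*} [CommRing R] [TopologicalSpace R]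

instance instBorelSpace' : BorelSpace (SpecialLinearGroup n R) := ⟨rfl⟩

lemma continuous_val' :
    Continuous fun g : SpecialLinearGroup n R ↦ (g : Matrix n n R) :=
  continuous_subtype_val

instance instT2Space' [T2Space R] : T2Space (SpecialLinearGroup n R) :=
  inferInstanceAs (T2Space {A : Matrix n n R // A.det = 1})

instance instSecondCountableTopology' [SecondCountableTopology R] :
    SecondCountableTopology (SpecialLinearGroup n R) :=
  have : SecondCountableTopology (Matrix n n R) :=
    inferInstanceAs (SecondCountableTopology (n → n → R))
  TopologicalSpace.Subtype.secondCountableTopology {A : Matrix n n R | A.det = 1}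

variable [IsTopologicalRing R]

instance instIsTopologicalGroup' : IsTopologicalGroup (SpecialLinearGroup n R) where
  continuous_inv := continuous_induced_rng.mpr continuous_induced_dom.matrix_adjugate
  continuous_mul := continuous_induced_rng.mpr <|
    (continuous_induced_dom.comp continuous_fst).mul (continuous_induced_dom.comp continuous_snd)

lemma isClosedEmbedding_val' [T2Space R] :
    Topology.IsClosedEmbedding fun g : SpecialLinearGroup n R ↦ (g : Matrix n n R) :=
  (isClosed_singleton.preimage continuous_id.matrix_det).isClosedEmbedding_subtypeVal

instance instLocallyCompactSpace' [T2Space R] [LocallyCompactSpace R] :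
    LocallyCompactSpace (SpecialLinearGroup n R) :=
  have : LocallyCompactSpace (Matrix n n R) :=
    inferInstanceAs (LocallyCompactSpace (n → n → R))
  isClosedEmbedding_val'.locallyCompactSpace

end Matrix.SpecialLinearGroup

noncomputable section

namespace PrimeTup

variable {S : PrimeTup} {d : ℕ}


instance instMulActionQS : MulAction (S.G d) (S.QS d) where
  smul g x := S.act g x
  one_smul x := by
    change S.act 1 x = x
    ext <;> simp [act]
  mul_smul g h x := by
    change S.act (g * h) x = S.act g (S.act h x)
    ext <;> simp [act, Matrix.mulVec_mulVec]

lemma smul_def (g : S.G d) (x : S.QS d) : g • x = S.act g x := rfl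

@[simp] lemma smul_fst (g : S.G d) (x : S.QS d) :
    (g • x).1 = (g.1 : Matrix (Fin d) (Fin d) ℝ).mulVec x.1 := rfl

@[simp] lemma smul_snd (g : S.G d) (x : S.QS d) (i : Fin S.s) :
    (g • x).2 i = (g.2 i : Matrix (Fin d) (Fin d) (S.Qp i)).mulVec (x.2 i) := rfl

instance : ContinuousSMul (S.G d) (S.QS d) where
  continuous_smul := by
    refine Continuous.prodMk ?_ (continuous_pi fun i ↦ ?_)
    · exact (SpecialLinearGroup.continuous_val'.comp
        (continuous_fst.comp continuous_fst)).matrix_mulVec (continuous_fst.comp continuous_snd)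
    · exact (SpecialLinearGroup.continuous_val'.comp
        ((continuous_apply i).comp (continuous_snd.comp continuous_fst))).matrix_mulVec
        ((continuous_apply i).comp (continuous_snd.comp continuous_snd))

instance : DistribMulAction (S.G d) (S.QS d) where
  smul_zero g := by ext <;> simp
  smul_add g x y := by ext <;> simp [Matrix.mulVec_add]

instance (k : ℕ) : MeasurableSMul₂ (S.G d) (Fin k → S.QS d) :=
  ⟨measurable_pi_lambda _ fun j ↦
    measurable_fst.smul ((measurable_pi_apply j).comp measurable_snd)⟩

instance : Countable (S.Zs) := inferInstanceAs (Countable {q // q ∈ S.Zs})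

instance : Countable (SpecialLinearGroup (Fin d) S.Zs) :=
  have : Countable (Matrix (Fin d) (Fin d) S.Zs) :=
    inferInstanceAs (Countable (Fin d → Fin d → S.Zs))
  Subtype.countable

instance : Countable (S.Gamma d) := by
  have : (S.Gamma d : Set (S.G d)).Countable := Set.countable_range (S.toG d)
  exact this

@[simp] lemma diag_add (v w : Fin d → ℚ) : S.diag (v + w) = S.diag v + S.diag w := by
  ext <;> simp [diag]

@[simp] lemma diag_sub (v w : Fin d → ℚ) : S.diag (v - w) = S.diag v - S.diag w := by
  ext <;> simp [diag]

/-- The diagonal image in `ℚ_S^d` of a vector of `ℤ_S^d`. -/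
def dz (v : Fin d → S.Zs) : S.QS d := S.diag fun j ↦ (v j : ℚ)

lemma dz_add (v w : Fin d → S.Zs) : dz (v + w) = dz v + dz w := by
  rw [dz, dz, dz, ← diag_add]
  rfl

lemma dz_sub (v w : Fin d → S.Zs) : dz (v - w) = dz v - dz w := by
  rw [dz, dz, dz, ← diag_sub]
  rfl

lemma toG_smul_dz (γ : SpecialLinearGroup (Fin d) S.Zs) (v : Fin d → S.Zs) :
    S.toG d γ • dz v = dz ((γ : Matrix (Fin d) (Fin d) S.Zs).mulVec v) := by
  ext i
  · simp [toG, dz, diag, Matrix.mulVec, dotProduct]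
  · rename_i j
    have : ((S.toG d γ).2 i : Matrix (Fin d) (Fin d) (S.Qp i)) =
        (γ : Matrix (Fin d) (Fin d) S.Zs).map ((Rat.castHom (S.Qp i)).comp S.Zs.subtype) := rfl
    rw [smul_snd, this]
    simp [dz, diag, Matrix.mulVec, dotProduct]

end PrimeTup

end

section GLCharacter

variable {n : Type*} [Fintype n] [DecidableEq n] {F : Type*} [Field F]

/-- The diagonal matrices as a subgroup of the general linear group. -/
def Matrix.GeneralLinearGroup.diagHom (n F : Type*) [Fintype n] [DecidableEq n] [Field F] :
    (n → Fˣ) →* GL n F :=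
  (Units.map (Matrix.diagonalRingHom n F).toMonoidHom).comp
    (MulEquiv.piUnits (M := fun _ : n ↦ F)).symm.toMonoidHom

lemma Matrix.GeneralLinearGroup.coe_diagHom (D : n → Fˣ) :
    (diagHom n F D : Matrix n n F) = Matrix.diagonal fun i ↦ (D i : F) := rfl

/-- A character of `GL n F` with values in the nonnegative reals factors through the
determinant. -/
lemma Matrix.GeneralLinearGroup.char_eq_one_of_det_eq_one [Nonempty n] (χ : GL n F →* NNReal) (g : GL n F)
    (hg : (g : Matrix n n F).det = 1) : χ g = 1 := by
  obtain ⟨i₀⟩ := ‹Nonempty n›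
  let f : Fˣ →* NNReal := (χ.comp (diagHom n F)).comp (MonoidHom.mulSingle (fun _ ↦ Fˣ) i₀)
  have hconj : ∀ g h : GL n F, χ (g * h * g⁻¹) = χ h := by
    intro g h
    rw [map_mul, map_mul, mul_right_comm, ← map_mul, mul_inv_cancel, map_one, one_mul]
  have hsingle : ∀ i (a : Fˣ), χ (diagHom n F (Pi.mulSingle i a)) = f a := by
    intro i a
    let P : GL n F := GeneralLinearGroup.mkOfDetNeZero (Matrix.swap F i i₀) (by
      rw [Matrix.swap, Matrix.det_permutation]
      rcases Int.units_eq_one_or (Equiv.Perm.sign (Equiv.swap i i₀)) with h | h <;> simp [h])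
    have : P * diagHom n F (Pi.mulSingle i₀ a) * P⁻¹ = diagHom n F (Pi.mulSingle i a) := by
      rw [mul_inv_eq_iff_eq_mul]
      ext k l
      have hP : (P : Matrix n n F) = Matrix.swap F i i₀ := rfl
      simp only [Units.val_mul, coe_diagHom, hP, Matrix.mul_diagonal, Matrix.diagonal_mul,
        Matrix.swap, Equiv.toPEquiv_apply, PEquiv.toMatrix_apply]
      by_cases hl : Equiv.swap i i₀ k = l
      · have : (Pi.mulSingle i₀ a : n → Fˣ) l = (Pi.mulSingle i a : n → Fˣ) k := by
          simp only [Pi.mulSingle_apply, ← hl, Equiv.swap_apply_eq_iff, Equiv.swap_apply_right]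
        rw [this, mul_comm]
      · simp [hl]
    rw [← this, hconj]
    rfl
  have hdiag : ∀ D : n → Fˣ, χ (diagHom n F D) = f (∏ i, D i) := by
    intro D
    conv_lhs => rw [← Finset.univ_prod_mulSingle D]
    rw [← MonoidHom.comp_apply, map_prod, map_prod]
    exact Finset.prod_congr rfl fun i _ ↦ hsingle i (D i)
  have key : ∀ M : Matrix n n F, M.det ≠ 0 → ∀ g : GL n F, (g : Matrix n n F) = M →
      χ g = f (GeneralLinearGroup.det g) := by
    intro M hM
    refine Matrix.diagonal_transvection_induction_of_det_ne_zero (fun M ↦ ∀ g : GL n F,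
      (g : Matrix n n F) = M → χ g = f (GeneralLinearGroup.det g)) M hM ?_ ?_ ?_
    · intro D hD g hg
      rw [Matrix.det_diagonal, Finset.prod_ne_zero_iff] at hD
      have : g = diagHom n F (fun i ↦ Units.mk0 (D i) (hD i (Finset.mem_univ i))) := by
        ext1
        rw [hg, coe_diagHom]
        rfl
      rw [this, hdiag]
      congr 1
      ext1
      simp [coe_diagHom]
    · intro t g hg
      let D : GL n F := diagHom n F (Pi.mulSingle t.i (-1))
      have hD : D * g * D⁻¹ = g⁻¹ := by
        rw [mul_inv_eq_iff_eq_mul, eq_inv_mul_iff_mul_eq]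
        ext1
        have hij := t.hij
        simp only [Units.val_mul, hg, D, coe_diagHom, TransvectionStruct.toMatrix,
          Matrix.transvection]
        have hl : (Matrix.diagonal fun k ↦ ((Pi.mulSingle t.i (-1) : n → Fˣ) k : F)) *
            Matrix.single t.i t.j t.c = -Matrix.single t.i t.j t.c := by
          ext k l
          by_cases hk : k = t.i
          · simp [hk, Matrix.diagonal_mul]
          · simp [Matrix.diagonal_mul, Ne.symm hk]
        have hr : Matrix.single t.i t.j t.c * (Matrix.diagonal fun k ↦
            ((Pi.mulSingle t.i (-1) : n → Fˣ) k : F)) = Matrix.single t.i t.j t.c := by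
          ext k l
          by_cases hk : l = t.j
          · simp [hk, Matrix.mul_diagonal, Pi.mulSingle_apply, hij.symm]
          · simp [Matrix.mul_diagonal, Ne.symm hk]
        rw [mul_add, hl, mul_one, add_mul, one_mul, mul_add, hr, mul_neg,
          Matrix.single_mul_single_of_ne _ _ _ _ hij.symm]
        abel
      have h1 : χ g * χ g = 1 := by
        conv_lhs => enter [1]; rw [← hconj D g, hD]
        rw [map_inv, inv_mul_cancel₀]
        exact (Group.isUnit g).map χ |>.ne_zero
      have h2 : GeneralLinearGroup.det g = 1 := by
        ext1
        simp [hg]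
      rw [h2, map_one]
      exact by simpa using (pow_eq_one_iff_of_nonneg zero_le (two_ne_zero)).1 ((sq (χ g)).trans h1)
    · intro A B hA hB iA iB g hg
      have : g = GeneralLinearGroup.mkOfDetNeZero A hA * GeneralLinearGroup.mkOfDetNeZero B hB := by
        ext1
        simp [hg, GeneralLinearGroup.mkOfDetNeZero]
      rw [this, map_mul, map_mul, map_mul, iA _ rfl, iB _ rfl]
  rw [key _ (by simp [hg]) g rfl]
  have : GeneralLinearGroup.det g = 1 := by
    ext1
    exact hg
  rw [this, map_one]

end GLCharacter

section PlaceMeasure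

open Measure
open scoped Pointwise

variable {n F : Type*} [Fintype n] [DecidableEq n] [Field F] [TopologicalSpace F]
  [IsTopologicalRing F] [LocallyCompactSpace F] [MeasurableSpace (n → F)] [BorelSpace (n → F)]

instance : ContinuousConstSMul (GL n F) (n → F) where
  continuous_const_smul g := by
    change Continuous fun x ↦ (g : Matrix n n F).mulVec x
    fun_prop

/-- Haar measure on `Fⁿ` is invariant under the special linear group. -/
lemma measurePreserving_mulVec (m : Measure (n → F)) [m.IsAddHaarMeasure] [m.Regular]
    (g : SpecialLinearGroup n F) :
    MeasurePreserving (fun x ↦ (g : Matrix n n F).mulVec x) m m := by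
  rcases isEmpty_or_nonempty n with hn | hn
  · convert MeasurePreserving.id m
  have hc : Continuous fun x : n → F ↦ (g : Matrix n n F).mulVec x := by fun_prop
  refine ⟨hc.measurable, ?_⟩
  ext s hs
  rw [map_apply hc.measurable hs]
  have h1 : (fun x ↦ (g : Matrix n n F).mulVec x) ⁻¹' s =
      (SpecialLinearGroup.toGL g)⁻¹ • s := by
    rw [← Set.preimage_smul]
    rfl
  rw [h1, ← distribHaarChar_mul, map_inv,
    GeneralLinearGroup.char_eq_one_of_det_eq_one _ _ (by simp), inv_one, ENNReal.coe_one, one_mul]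

end PlaceMeasure

noncomputable section

namespace PrimeTup

open Measure
open scoped Pointwise

variable {S : PrimeTup} {d : ℕ}

/-- The box `ℤ_pᵈ`. -/
def boxp (S : PrimeTup) (d : ℕ) (i : Fin S.s) : Set (Fin d → S.Qp i) := {x | ∀ j, ‖x j‖ ≤ 1}

lemma boxp_eq (i : Fin S.s) : S.boxp d i = Metric.closedBall 0 1 := by
  ext x
  simp [boxp, pi_norm_le_iff_of_nonneg zero_le_one]

lemma isCompact_boxp (i : Fin S.s) : IsCompact (S.boxp d i) := by
  rw [boxp_eq]
  exact isCompact_closedBall _ _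

lemma interior_boxp_nonempty (i : Fin S.s) : (interior (S.boxp d i)).Nonempty := by
  rw [boxp_eq]
  exact ⟨0, Metric.ball_subset_interior_closedBall (Metric.mem_ball_self one_pos)⟩

/-- The Haar measure on `ℚ_pᵈ` normalized by `ℤ_pᵈ`. -/
def volp (S : PrimeTup) (d : ℕ) (i : Fin S.s) : Measure (Fin d → S.Qp i) :=
  addHaarMeasure ⟨⟨S.boxp d i, isCompact_boxp i⟩, interior_boxp_nonempty i⟩

instance (i : Fin S.s) : (S.volp d i).IsAddHaarMeasure := by unfold volp; infer_instance

lemma volp_boxp (i : Fin S.s) : S.volp d i (S.boxp d i) = 1 :=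
  addHaarMeasure_self (K₀ := ⟨⟨S.boxp d i, isCompact_boxp i⟩, interior_boxp_nonempty i⟩)

/-- The measure `vol_S` as a product measure. -/
def vol (S : PrimeTup) (d : ℕ) : Measure (S.QS d) :=
  (volume : Measure (Fin d → ℝ)).prod (Measure.pi fun i ↦ S.volp d i)

instance : (S.vol d).IsAddHaarMeasure := prod.instIsAddHaarMeasure _ _

lemma vol_prod (A : Set (Fin d → ℝ)) (B : (i : Fin S.s) → Set (Fin d → S.Qp i)) :
    S.vol d (A ×ˢ Set.univ.pi B) = volume A * ∏ i, S.volp d i (B i) := by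
  rw [vol, prod_prod, Measure.pi_pi]

lemma unitBox_eq : S.unitBox d = Set.Icc 0 1 ×ˢ Set.univ.pi fun i ↦ S.boxp d i := by
  ext x
  simp [unitBox, boxp, Set.mem_pi, Pi.le_def, forall_and]

lemma vol_unitBox : S.vol d (S.unitBox d) = 1 := by
  rw [unitBox_eq, vol_prod]
  simp [volp_boxp, Real.volume_Icc_pi]

lemma IsVolS.eq_vol {v : Measure (S.QS d)} (hv : S.IsVolS d v) : v = S.vol d := by
  obtain ⟨h1, h2, h3⟩ := hv
  have h := isAddLeftInvariant_eq_smul v (S.vol d)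
  have h4 := congrArg (fun m ↦ m (S.unitBox d)) h
  simp only [h3, Measure.smul_apply, vol_unitBox] at h4
  rw [h]
  have : addHaarScalarFactor v (S.vol d) = 1 := by
    have : ((addHaarScalarFactor v (S.vol d) : NNReal) : ℝ≥0∞) = 1 := by
      simpa [ENNReal.smul_def] using h4.symm
    exact_mod_cast this
  rw [this, one_smul]

instance : SMulInvariantMeasure (S.G d) (S.QS d) (S.vol d) := by
  refine ⟨fun g s hs ↦ ?_⟩
  have h : MeasurePreserving (fun x : S.QS d ↦ g • x) (S.vol d) (S.vol d) :=
    (measurePreserving_mulVec (volume : Measure (Fin d → ℝ)) g.1).prod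
      (measurePreserving_pi _ _ fun i ↦ measurePreserving_mulVec (S.volp d i) (g.2 i))
  exact h.measure_preimage hs.nullMeasurableSet

/-- Contractions by a `p`-adic scalar. -/
lemma volp_smul_le {i : Fin S.s} {a : S.Qp i} (ha : a ≠ 0) (h1 : ‖a‖ ≤ 1)
    (B : Set (Fin d → S.Qp i)) :
    S.volp d i ((fun x ↦ a • x) '' B) ≤ ENNReal.ofReal (‖a‖ ^ d) * S.volp d i B := by
  have himg : (fun x ↦ a • x) '' B = Units.mk0 a ha • B := rfl
  rw [himg, ← distribHaarChar_mul]
  gcongr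
  have hp : (0 : ℝ) < S.p i := by exact_mod_cast (S.hp i).pos
  have hp1 : (1 : ℝ) < S.p i := by exact_mod_cast (S.hp i).one_lt
  obtain ⟨k, hk⟩ : ∃ k : ℕ, ‖a‖ = (S.p i : ℝ) ^ (-(k : ℤ)) := by
    have h2 := Padic.norm_eq_zpow_neg_valuation ha
    have h3 : 0 ≤ a.valuation := by
      rw [h2] at h1
      by_contra hc
      exact absurd h1 (not_le.2 (one_lt_zpow₀ hp1 (by omega)))
    exact ⟨a.valuation.toNat, by rw [h2, Int.toNat_of_nonneg h3]⟩
  let T : (Fin d → Fin (S.p i ^ k)) → Set (Fin d → S.Qp i) := fun v ↦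
    (fun x ↦ (fun j ↦ ((v j : ℕ) : S.Qp i)) + x) '' (Units.mk0 a ha • S.boxp d i)
  have hT : ∀ v x, x ∈ T v → ∀ j, ‖x j - (v j : ℕ)‖ ≤ ‖a‖ := by
    rintro v _ ⟨_, ⟨y, hy, rfl⟩, rfl⟩ j
    have : ‖a * y j‖ ≤ ‖a‖ := by
      rw [norm_mul]
      exact mul_le_of_le_one_right (norm_nonneg _) (hy j)
    simpa using this
  have hdisj : Pairwise (Function.onFun Disjoint T) := by
    intro v w hvw
    refine Set.disjoint_left.2 fun x hv hw ↦ hvw ?_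
    funext j
    have h4 : ‖(((v j : ℕ) - (w j : ℕ) : ℤ) : S.Qp i)‖ ≤ ‖a‖ := by
      have : (((v j : ℕ) - (w j : ℕ) : ℤ) : S.Qp i) =
          (x j - (w j : ℕ)) - (x j - (v j : ℕ)) := by push_cast; ring
      rw [this]
      rw [sub_eq_add_neg]
      exact (Padic.nonarchimedean _ _).trans (max_le (hT w x hw j) (by
        rw [norm_neg]
        exact hT v x hv j))
    rw [hk, Padic.norm_int_le_pow_iff_dvd] at h4
    have h5 := (v j).2
    have h6 := (w j).2
    have h7 : ((v j : ℕ) : ℤ) - (w j : ℕ) = 0 := by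
      refine Int.eq_zero_of_abs_lt_dvd h4 ?_
      rw [abs_lt]
      push_cast [← @Nat.cast_lt ℤ] at h5 h6
      constructor <;> omega
    exact Fin.ext (by omega)
  have hmeas : MeasurableSet (Units.mk0 a ha • S.boxp d i) :=
    ((isCompact_boxp i).smul (Units.mk0 a ha)).measurableSet
  have hTm : ∀ v, MeasurableSet (T v) := fun v ↦ by
    simp only [T, Set.image_add_left]
    exact hmeas.preimage (measurable_const_add _)
  have hTv : ∀ v, S.volp d i (T v) = distribHaarChar (Fin d → S.Qp i) (Units.mk0 a ha) := fun v ↦ by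
    simp only [T, Set.image_add_left, measure_preimage_add]
    rw [← distribHaarChar_mul, volp_boxp, mul_one]
  have hsub : ⋃ v, T v ⊆ S.boxp d i := by
    refine Set.iUnion_subset fun v x hx j ↦ ?_
    have : x j = (x j - (v j : ℕ)) + ((v j : ℕ) : ℤ) := by push_cast; ring
    rw [this]
    exact (Padic.nonarchimedean _ _).trans
      (max_le ((hT v x hx j).trans h1) (Padic.norm_int_le_one _))
  have key := measure_mono (μ := S.volp d i) hsub
  rw [measure_iUnion hdisj hTm, volp_boxp, tsum_fintype] at key
  simp only [hTv, Finset.sum_const, Finset.card_univ, Fintype.card_pi, Fintype.card_fin,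
    Finset.prod_const, nsmul_eq_mul] at key
  rw [hk, _root_.zpow_neg, zpow_natCast, inv_pow, ENNReal.ofReal_inv_of_pos (by positivity),
    ← one_div, ENNReal.le_div_iff_mul_le]
  · rw [mul_comm]
    refine le_trans (le_of_eq ?_) key
    congr 1
    rw [← pow_mul]
    norm_cast
    rw [← pow_mul]
  · left
    simp [(S.hp i).ne_zero]
  · left
    simp

end PrimeTup

end

namespace PrimeTup

variable {S : PrimeTup} {d : ℕ}

lemma _root_.Padic.not_dvd_den {p : ℕ} [Fact p.Prime] {q : ℚ} (h : ‖(q : ℚ_[p])‖ ≤ 1) :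
    ¬ p ∣ q.den := by
  intro hd
  have h1 : ‖(q.den : ℚ_[p])‖ < 1 := Padic.norm_natCast_lt_one_iff.2 hd
  have h2 : ‖(q.num : ℚ_[p])‖ < 1 := by
    have h3 : (q.num : ℚ_[p]) = q * q.den := by exact_mod_cast (Rat.mul_den_eq_num q).symm
    rw [h3, norm_mul]
    exact mul_lt_one_of_nonneg_of_lt_one_right h (norm_nonneg _) h1
  have h4 : p ∣ q.num.natAbs := Int.natCast_dvd.1 (Padic.norm_intCast_lt_one_iff.1 h2)
  exact (Fact.out : p.Prime).one_lt.ne' (Nat.eq_one_of_dvd_coprimes q.reduced h4 hd)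

lemma inv_mem_Zs (i : Fin S.s) : ((S.p i : ℚ))⁻¹ ∈ S.Zs := Subring.subset_closure ⟨i, rfl⟩

lemma inv_den_mem {q : ℚ} (hq : q ∈ S.Zs) : ((q.den : ℚ))⁻¹ ∈ S.Zs := by
  have h := q.isCoprime_num_den
  obtain ⟨a, b, hab⟩ := Int.isCoprime_iff_gcd_eq_one.2 (by simpa [Int.gcd] using q.reduced : Int.gcd q.num q.den = 1)
  have hd : (q.den : ℚ) ≠ 0 := by exact_mod_cast q.den_ne_zero
  have : ((q.den : ℚ))⁻¹ = a * q + b := by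
    have h2 : (a : ℚ) * q.num + b * q.den = 1 := by exact_mod_cast hab
    have h3 : (q.num : ℚ) = q * q.den := (Rat.mul_den_eq_num q).symm
    rw [h3] at h2
    field_simp
    linarith
  rw [this]
  exact add_mem (mul_mem (intCast_mem _ _) hq) (intCast_mem _ _)

/-- Denominators of `S`-integers only involve primes of `S`. -/
lemma exists_eq_of_dvd_den {q : ℚ} (hq : q ∈ S.Zs) {l : ℕ} (hl : l.Prime) (h : l ∣ q.den) :
    ∃ i, l = S.p i := by
  by_contra! hc
  have : Fact l.Prime := ⟨hl⟩
  have key : ∀ x ∈ S.Zs, ‖(x : ℚ_[l])‖ ≤ 1 := by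
    intro x hx
    induction hx using Subring.closure_induction with
    | mem x hx =>
      obtain ⟨i, rfl⟩ := hx
      have : ‖((S.p i : ℤ) : ℚ_[l])‖ = 1 := by
        refine le_antisymm (Padic.norm_int_le_one _) (not_lt.1 fun hlt ↦ hc i ?_)
        rw [Padic.norm_intCast_lt_one_iff] at hlt
        exact (Nat.prime_dvd_prime_iff_eq hl (S.hp i)).1 (by exact_mod_cast hlt)
      push_cast at this ⊢
      simp [this]
    | zero => simp
    | one => simp
    | add x y _ _ hx hy =>
      push_cast
      exact (Padic.nonarchimedean _ _).trans (max_le hx hy)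
    | neg x _ hx => simpa using hx
    | mul x y _ _ hx hy =>
      push_cast
      rw [norm_mul]
      exact mul_le_one₀ hx (norm_nonneg _) hy
  have h1 := key q hq
  exact Padic.not_dvd_den h1 h

instance : IsPrincipalIdealRing S.Zs := by
  refine ⟨fun I ↦ ?_⟩
  obtain ⟨n, hn⟩ := (IsPrincipalIdealRing.principal (I.comap (Int.castRingHom S.Zs))).principal
  refine ⟨(n : S.Zs), le_antisymm (fun x hx ↦ ?_) ?_⟩
  · let w : S.Zs := ⟨_, inv_den_mem x.2⟩
    have h1 : ((x : ℚ).num : S.Zs) = ((x : ℚ).den : S.Zs) * x := by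
      ext
      push_cast
      rw [mul_comm]
      exact (Rat.mul_den_eq_num _).symm
    have h2 : (x : ℚ).num ∈ I.comap (Int.castRingHom S.Zs) := by
      rw [Ideal.mem_comap]
      simp only [eq_intCast]
      rw [h1]
      exact I.mul_mem_left _ hx
    rw [hn] at h2
    obtain ⟨c, hc⟩ := Ideal.mem_span_singleton'.1 h2
    refine Ideal.mem_span_singleton'.2 ⟨w * c, ?_⟩
    ext
    have : ((c : ℚ)) * n = (x : ℚ).num := by exact_mod_cast hc
    push_cast
    rw [mul_assoc, this]
    change ((x : ℚ).den : ℚ)⁻¹ * _ = _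
    rw [inv_mul_eq_div, Rat.num_div_den]
  · refine (Ideal.span_singleton_le_iff_mem _).2 ?_
    have : n ∈ I.comap (Int.castRingHom S.Zs) := by
      rw [hn]; exact Ideal.mem_span_singleton_self _
    simpa using this

/-- The unit `pᵢ` of `ℤ_S`. -/
lemma isUnit_prime (i : Fin S.s) : IsUnit ((S.p i : ℕ) : S.Zs) := by
  refine IsUnit.of_mul_eq_one ⟨_, inv_mem_Zs i⟩ ?_
  ext
  have : (S.p i : ℚ) ≠ 0 := by exact_mod_cast (S.hp i).ne_zero
  push_cast
  exact mul_inv_cancel₀ this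

lemma exists_unit_mul_natCast {n : ℕ} (hn : 0 < n) :
    ∃ m ∈ S.NS, ∃ u : S.Zsˣ, (n : S.Zs) = u * m := by
  induction n using Nat.strong_induction_on with
  | _ n ih =>
    by_cases h : ∃ i, S.p i ∣ n
    · obtain ⟨i, k, rfl⟩ := h
      have hk : 0 < k := Nat.pos_of_mul_pos_left hn
      obtain ⟨m, hm, u, hu⟩ := ih k (by nlinarith [(S.hp i).two_le]) hk
      obtain ⟨v, hv⟩ := isUnit_prime i
      exact ⟨m, hm, v * u, by push_cast; rw [hu, ← hv, mul_assoc]⟩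
    · push Not at h
      exact ⟨n, ⟨hn, h⟩, 1, by simp⟩

lemma exists_unit_mul {x : S.Zs} (hx : x ≠ 0) : ∃ m ∈ S.NS, ∃ u : S.Zsˣ, x = u * m := by
  have hd : IsUnit ((x : ℚ).den : S.Zs) := by
    refine IsUnit.of_mul_eq_one ⟨_, inv_den_mem x.2⟩ ?_
    ext
    push_cast
    exact mul_inv_cancel₀ (by exact_mod_cast (x : ℚ).den_ne_zero)
  obtain ⟨w, hw⟩ := hd
  have h1 : (w : S.Zs) * x = ((x : ℚ).num : S.Zs) := by
    ext
    rw [hw]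
    push_cast
    rw [mul_comm]
    exact (Rat.mul_den_eq_num _)
  have h0 : (x : ℚ).num ≠ 0 := by simpa using hx
  obtain ⟨m, hm, u, hu⟩ := exists_unit_mul_natCast (S := S) (Int.natAbs_pos.2 h0)
  have hx2 : x = (w⁻¹ : S.Zsˣ) * ((x : ℚ).num : S.Zs) := by
    rw [← h1, Units.inv_mul_cancel_left]
  obtain h | h := Int.natAbs_eq (x : ℚ).num
  · refine ⟨m, hm, w⁻¹ * u, ?_⟩
    rw [Units.val_mul, mul_assoc, ← hu]
    nth_rw 1 [hx2]
    congr 1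
    rw [h]
    simp
  · refine ⟨m, hm, -(w⁻¹ * u), ?_⟩
    rw [Units.val_neg, Units.val_mul, neg_mul, mul_assoc, ← hu]
    nth_rw 1 [hx2]
    rw [← mul_neg]
    congr 1
    nth_rw 1 [h]
    simp

/-- `ℤ_S` is discrete: an `S`-integer integral at all primes of `S` is an integer. -/
lemma den_eq_one {q : ℚ} (hq : q ∈ S.Zs) (h : ∀ i, ‖(q : S.Qp i)‖ ≤ 1) : q.den = 1 := by
  by_contra hne
  obtain ⟨l, hl, hd⟩ := Nat.exists_prime_and_dvd hne
  obtain ⟨i, rfl⟩ := exists_eq_of_dvd_den hq hl hd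
  exact Padic.not_dvd_den (h i) hd

lemma den_mul_prod_eq_one {q : ℚ} (hq : q ∈ S.Zs) (k : Fin S.s → ℕ)
    (h : ∀ i, ‖(q : S.Qp i)‖ ≤ (S.p i : ℝ) ^ k i) : (q * (∏ i, S.p i ^ k i : ℕ)).den = 1 := by
  set P : ℕ := ∏ i, S.p i ^ k i
  have hPi : ∀ i, ‖(P : S.Qp i)‖ ≤ ((S.p i : ℝ) ^ k i)⁻¹ := fun i ↦ by
    have : ((S.p i ^ k i : ℕ) : ℤ) ∣ (P : ℤ) := by
      exact_mod_cast Finset.dvd_prod_of_mem (fun i ↦ S.p i ^ k i) (Finset.mem_univ i)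
    have h := (Padic.norm_int_le_pow_iff_dvd (p := S.p i) (P : ℤ) (k i)).2 (by exact_mod_cast this)
    simpa [_root_.zpow_neg] using h
  refine den_eq_one (S := S) (mul_mem hq (natCast_mem _ _)) fun i ↦ ?_
  push_cast
  rw [norm_mul]
  have hp : (0 : ℝ) < (S.p i : ℝ) ^ k i := pow_pos (by exact_mod_cast (S.hp i).pos) _
  calc _ ≤ (S.p i : ℝ) ^ k i * ((S.p i : ℝ) ^ k i)⁻¹ :=
        mul_le_mul (h i) (hPi i) (norm_nonneg _) hp.le
    _ = 1 := mul_inv_cancel₀ hp.ne'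

/-- Only finitely many `S`-integers lie in a bounded set. -/
lemma finite_Zs_bounded (B : ℝ) (C : Fin S.s → ℝ) :
    {q : S.Zs | |((q : ℚ) : ℝ)| ≤ B ∧ ∀ i, ‖((q : ℚ) : S.Qp i)‖ ≤ C i}.Finite := by
  have h1 : ∀ i, ∃ k : ℕ, C i ≤ (S.p i : ℝ) ^ k := fun i ↦
    (pow_unbounded_of_one_lt _ (by exact_mod_cast (S.hp i).one_lt)).imp fun _ h ↦ h.le
  choose k hk using h1
  let P : ℕ := ∏ i, S.p i ^ k i
  have hP0 : (P : ℚ) ≠ 0 := by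
    exact_mod_cast Finset.prod_ne_zero_iff.2 fun i _ ↦ pow_ne_zero _ (S.hp i).ne_zero
  let F : ℤ → ℚ := fun z ↦ z / P
  refine Set.Finite.subset (s := (fun q : S.Zs ↦ (q : ℚ)) ⁻¹' (F '' Set.Icc (-⌈B * P⌉) ⌈B * P⌉))
    (Set.Finite.preimage Subtype.val_injective.injOn ((Set.finite_Icc _ _).image _)) ?_
  rintro q ⟨hq1, hq2⟩
  have hden : ((q : ℚ) * P).den = 1 := den_mul_prod_eq_one q.2 k fun i ↦ (hq2 i).trans (hk i)
  have hz : ((((q : ℚ) * P).num : ℤ) : ℚ) = (q : ℚ) * P := Rat.coe_int_num_of_den_eq_one hden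
  refine ⟨((q : ℚ) * P).num, ?_, ?_⟩
  · have h2 : |((((q : ℚ) * P).num : ℤ) : ℝ)| ≤ B * P := by
      have : ((((q : ℚ) * P).num : ℤ) : ℝ) = ((q : ℚ) : ℝ) * P := by exact_mod_cast hz
      rw [this, abs_mul, Nat.abs_cast]
      gcongr
    rw [abs_le] at h2
    have h3 := Int.le_ceil (B * P)
    constructor
    · have : ((-⌈B * P⌉ : ℤ) : ℝ) ≤ (((q : ℚ) * P).num : ℤ) := by push_cast; linarith
      exact_mod_cast this
    · have : (((q : ℚ) * P).num : ℝ) ≤ (⌈B * P⌉ : ℤ) := by linarith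
      exact_mod_cast this
  · simp only [F]
    rw [hz]
    field_simp

lemma exists_approx_padic (i : Fin S.s) (x : S.Qp i) :
    ∃ q : S.Zs, ‖x - ((q : ℚ) : S.Qp i)‖ ≤ 1 ∧ ∀ j ≠ i, ‖((q : ℚ) : S.Qp j)‖ ≤ 1 := by
  have hp1 : (1 : ℝ) < S.p i := by exact_mod_cast (S.hp i).one_lt
  obtain ⟨k, hk⟩ := pow_unbounded_of_one_lt ‖x‖ hp1
  have hpk : (0 : ℝ) < (S.p i : ℝ) ^ k := by positivity
  have hpi : ‖((S.p i : S.Qp i)) ^ k‖ = ((S.p i : ℝ) ^ k)⁻¹ := by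
    rw [norm_pow, Padic.norm_p, inv_pow]
  have hy : ‖x * (S.p i : S.Qp i) ^ k‖ ≤ 1 := by
    rw [norm_mul, hpi, ← div_eq_mul_inv, div_le_one hpk]
    exact hk.le
  obtain ⟨a, ha⟩ := PadicInt.denseRange_natCast.exists_dist_lt
    (⟨x * (S.p i : S.Qp i) ^ k, hy⟩ : ℤ_[S.p i]) (inv_pos.2 hpk)
  replace ha : ‖x * (S.p i : S.Qp i) ^ k - a‖ < ((S.p i : ℝ) ^ k)⁻¹ := by
    have h := ha
    erw [Subtype.dist_eq, dist_eq_norm] at h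
    exact h
  have hp0 : (S.p i : S.Qp i) ^ k ≠ 0 := by
    rw [← norm_ne_zero_iff, hpi]
    positivity
  refine ⟨⟨a * ((S.p i : ℚ)⁻¹) ^ k, mul_mem (natCast_mem _ _) (pow_mem (inv_mem_Zs i) _)⟩,
    ?_, fun j hj ↦ ?_⟩
  · have : x - (((a : ℚ) * ((S.p i : ℚ)⁻¹) ^ k : ℚ) : S.Qp i) =
        (x * (S.p i : S.Qp i) ^ k - a) * ((S.p i : S.Qp i) ^ k)⁻¹ := by
      push_cast
      rw [sub_mul, mul_inv_cancel_right₀ hp0, inv_pow]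
    change ‖x - (((a : ℚ) * ((S.p i : ℚ)⁻¹) ^ k : ℚ) : S.Qp i)‖ ≤ 1
    rw [this, norm_mul, norm_inv, hpi, inv_inv]
    calc _ ≤ ((S.p i : ℝ) ^ k)⁻¹ * (S.p i : ℝ) ^ k := by gcongr
      _ = 1 := inv_mul_cancel₀ hpk.ne'
  · change ‖(((a : ℚ) * ((S.p i : ℚ)⁻¹) ^ k : ℚ) : S.Qp j)‖ ≤ 1
    have h1 : ‖((S.p i : ℕ) : S.Qp j)‖ = 1 := Padic.norm_natCast_eq_one_iff.2
      ((Nat.coprime_primes (S.hp j) (S.hp i)).2 fun h ↦ hj (S.inj h))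
    push_cast
    rw [norm_mul, norm_pow, norm_inv, h1, inv_one, one_pow, mul_one]
    exact_mod_cast Padic.norm_int_le_one (a : ℤ)

/-- `ℚ_S = ℤ_S + [0,1] × ∏ ℤ_p`. -/
lemma exists_approx (x : ℝ) (y : (i : Fin S.s) → S.Qp i) :
    ∃ q : S.Zs, x - ((q : ℚ) : ℝ) ∈ Set.Icc (0 : ℝ) 1 ∧ ∀ i, ‖y i - ((q : ℚ) : S.Qp i)‖ ≤ 1 := by
  choose r hr hr' using fun i ↦ exists_approx_padic i (y i)
  let t : S.Zs := ∑ i, r i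
  have ht : ∀ i, ‖y i - ((t : ℚ) : S.Qp i)‖ ≤ 1 := fun i ↦ by
    have : y i - ((t : ℚ) : S.Qp i) =
        (y i - ((r i : ℚ) : S.Qp i)) - ∑ j ∈ Finset.univ.erase i, ((r j : ℚ) : S.Qp i) := by
      simp only [t]
      rw [← Finset.add_sum_erase _ _ (Finset.mem_univ i)]
      push_cast
      ring
    rw [this, sub_eq_add_neg]
    refine (Padic.nonarchimedean _ _).trans (max_le (hr i) ?_)
    rw [norm_neg]
    refine IsUltrametricDist.norm_sum_le_of_forall_le_of_nonneg zero_le_one fun j hj ↦ ?_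
    exact hr' j i (Finset.ne_of_mem_erase hj).symm
  refine ⟨t + (⌊x - ((t : ℚ) : ℝ)⌋ : ℤ), ?_, fun i ↦ ?_⟩
  · have h1 := Int.floor_le (x - ((t : ℚ) : ℝ))
    have h2 := Int.lt_floor_add_one (x - ((t : ℚ) : ℝ))
    push_cast
    constructor <;> linarith
  · have : y i - (((t + (⌊x - ((t : ℚ) : ℝ)⌋ : ℤ) : S.Zs) : ℚ) : S.Qp i) =
        (y i - ((t : ℚ) : S.Qp i)) + ((-⌊x - ((t : ℚ) : ℝ)⌋ : ℤ) : S.Qp i) := by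
      push_cast
      ring
    rw [this]
    exact (Padic.nonarchimedean _ _).trans (max_le (ht i) (Padic.norm_int_le_one _))

end PrimeTup

section LinearAlgebra

variable {R : Type*} [CommRing R]

/-- The `j`-th standard basis vector of `Rᵈ`, indexed by a natural number. -/
def stdVec (R : Type*) [CommRing R] (d j : ℕ) : Fin d → R := fun i ↦ if i.1 = j then 1 else 0

lemma stdVec_eq_single {d : ℕ} (j : Fin d) : stdVec R d j = Pi.single j 1 := by
  ext i
  simp [stdVec, Pi.single_apply, Fin.ext_iff]

lemma mulVec_stdVec {d : ℕ} {m : Type*} (M : Matrix m (Fin d) R) (j : Fin d) :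
    M *ᵥ stdVec R d j = M.col j := by
  rw [stdVec_eq_single, mulVec_single_one]

lemma stdVec_append_left {k n : ℕ} {j : ℕ} (hj : j < k) :
    stdVec R (k + n) j = Fin.append (stdVec R k j) 0 := by
  ext i
  refine Fin.addCases (fun i ↦ ?_) (fun i ↦ ?_) i
  · simp [stdVec]
  · simp [stdVec]
    omega

lemma stdVec_append_right {k n : ℕ} : stdVec R (k + n) k = Fin.append 0 (stdVec R n 0) := by
  ext i
  refine Fin.addCases (fun i ↦ ?_) (fun i ↦ ?_) i
  · simp [stdVec, i.2.ne]
  · simp [stdVec]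

lemma exists_unimodular [IsDomain R] [IsPrincipalIdealRing R] {ι : Type*} [Fintype ι]
    {w : ι → R} (hw : w ≠ 0) :
    ∃ m : R, m ≠ 0 ∧ ∃ v a : ι → R, w = m • v ∧ a ⬝ᵥ v = 1 := by
  obtain ⟨m, hm⟩ := (IsPrincipalIdealRing.principal (Ideal.span (Set.range w))).principal
  have h1 : ∀ i, ∃ c, w i = m * c := fun i ↦ by
    have : w i ∈ Ideal.span (Set.range w) := Ideal.subset_span ⟨i, rfl⟩
    rw [hm] at this
    obtain ⟨c, hc⟩ := Ideal.mem_span_singleton'.1 this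
    exact ⟨c, by rw [← hc, mul_comm]⟩
  choose v hv using h1
  have hm0 : m ≠ 0 := by
    rintro rfl
    exact hw (funext fun i ↦ by simp [hv i])
  have h2 : m ∈ Ideal.span (Set.range w) := by
    rw [hm]; exact Ideal.mem_span_singleton_self m
  obtain ⟨a, ha⟩ := (Ideal.mem_span_range_iff_exists_fun (v := w)).1 h2
  refine ⟨m, hm0, v, a, funext hv, mul_left_cancel₀ hm0 ?_⟩
  rw [mul_one]
  nth_rw 2 [← ha]
  simp only [dotProduct, Finset.mul_sum, hv]
  exact Finset.sum_congr rfl fun i _ ↦ by ring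

/-- A unimodular vector over a principal ideal domain is the first column of a matrix of
determinant one. -/
lemma exists_SL_mulVec_eq [IsDomain R] [IsPrincipalIdealRing R] {n : ℕ} (hn : 2 ≤ n)
    {v a : Fin n → R} (h : a ⬝ᵥ v = 1) :
    ∃ γ : SpecialLinearGroup (Fin n) R, γ.1 *ᵥ stdVec R n 0 = v := by
  obtain ⟨n, rfl⟩ := Nat.exists_eq_add_of_le' hn
  let φ : (Fin (n + 2) → R) →ₗ[R] R := dotProductBilin R R a
  have hφ : φ v = 1 := h
  obtain ⟨m, b⟩ := Submodule.basisOfPid (Pi.basisFun R (Fin (n + 2))) (LinearMap.ker φ)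
  let B := Module.Basis.mkFinCons v b
    (fun c x hx hc ↦ by
      have := congrArg φ hc
      rw [map_add, LinearMap.mem_ker.1 hx, map_smul, hφ] at this
      simpa using this)
    (fun z ↦ ⟨-φ z, by simp [hφ]⟩)
  have hm : m + 1 = n + 2 := by
    have h1 := Module.finrank_eq_card_basis B
    rw [Module.finrank_fin_fun, Fintype.card_fin] at h1
    exact h1.symm
  obtain rfl : m = n + 1 := by omega
  have hB0 : B 0 = v := by simp [B]
  let M : Matrix (Fin (n + 2)) (Fin (n + 2)) R := (Pi.basisFun R (Fin (n + 2))).toMatrix B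
  have hM : IsUnit M.det := by
    refine (Matrix.isUnit_iff_isUnit_det _).1 ?_
    have := (Pi.basisFun R (Fin (n + 2))).invertibleToMatrix B
    exact isUnit_of_invertible M
  obtain ⟨u, hu⟩ := hM
  let D : Matrix (Fin (n + 2)) (Fin (n + 2)) R :=
    diagonal (Function.update 1 1 ((u⁻¹ : Rˣ) : R))
  refine ⟨⟨M * D, ?_⟩, ?_⟩
  · rw [det_mul, ← hu, det_diagonal, Finset.prod_update_of_mem (Finset.mem_univ _)]
    simp
  · change (M * D) *ᵥ _ = _
    rw [← mulVec_mulVec]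
    have h0 : D *ᵥ stdVec R (n + 2) 0 = stdVec R (n + 2) 0 := by
      have := stdVec_eq_single (R := R) (0 : Fin (n + 2))
      rw [Fin.val_zero] at this
      rw [this]
      simp only [D, diagonal_mulVec_single]
      simp
    rw [h0]
    have := mulVec_stdVec M 0
    rw [Fin.val_zero] at this
    rw [this]
    ext i
    simp [M, Module.Basis.toMatrix_apply, hB0]

/-- Block upper triangular matrices with an identity block in the upper left corner. -/
def blockSL {k n : ℕ} (B : Matrix (Fin k) (Fin n) R) (D : SpecialLinearGroup (Fin n) R) :
    SpecialLinearGroup (Fin (k + n)) R :=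
  ⟨(fromBlocks 1 B 0 D.1).submatrix finSumFinEquiv.symm finSumFinEquiv.symm, by
    rw [det_submatrix_equiv_self, det_fromBlocks_zero₂₁]
    simp⟩

lemma blockSL_mulVec {k n : ℕ} (B : Matrix (Fin k) (Fin n) R)
    (D : SpecialLinearGroup (Fin n) R) (x : Fin k → R) (y : Fin n → R) :
    (blockSL B D).1 *ᵥ Fin.append x y =
      Fin.append (x + B *ᵥ y) (D.1 *ᵥ y) := by
  change (fromBlocks 1 B 0 D.1).submatrix _ _ *ᵥ _ = _
  have h : Fin.append x y ∘ finSumFinEquiv = Sum.elim x y := by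
    ext i; cases i <;> simp
  rw [submatrix_mulVec_equiv, Equiv.symm_symm, h, fromBlocks_mulVec]
  ext i
  refine Fin.addCases (fun i ↦ ?_) (fun i ↦ ?_) i <;> simp [Function.comp_def]

lemma blockSL_mulVec_stdVec {k n : ℕ} (B : Matrix (Fin k) (Fin n) R)
    (D : SpecialLinearGroup (Fin n) R) {j : ℕ} (hj : j < k) :
    (blockSL B D).1 *ᵥ stdVec R (k + n) j = stdVec R (k + n) j := by
  rw [stdVec_append_left hj, blockSL_mulVec]
  simp

lemma exists_eq_blockSL {k n : ℕ} (g : SpecialLinearGroup (Fin (k + n)) R)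
    (hg : ∀ j < k, g.1 *ᵥ stdVec R (k + n) j = stdVec R (k + n) j) :
    ∃ B D, g = blockSL B D := by
  let M : Matrix (Fin k ⊕ Fin n) (Fin k ⊕ Fin n) R :=
    g.1.submatrix finSumFinEquiv finSumFinEquiv
  have hcol : ∀ (j : Fin k) i, g.1 i (Fin.castAdd n j) = if i.1 = j.1 then 1 else 0 :=
    fun j i ↦ by
      have h1 := hg j j.2
      have h2 := mulVec_stdVec g.1 (Fin.castAdd n j)
      rw [Fin.val_castAdd, h1] at h2
      exact (congrFun h2 i).symm
  have h11 : M.toBlocks₁₁ = 1 := by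
    ext i j
    simp [M, toBlocks₁₁, hcol, one_apply, Fin.ext_iff]
  have h21 : M.toBlocks₂₁ = 0 := by
    ext i j
    simp [M, toBlocks₂₁, hcol]
    omega
  have hM : M = fromBlocks 1 M.toBlocks₁₂ 0 M.toBlocks₂₂ := by
    rw [← h11, ← h21, fromBlocks_toBlocks]
  have hdet : M.det = 1 := by
    rw [det_submatrix_equiv_self]
    exact g.2
  rw [hM, det_fromBlocks_zero₂₁, det_one, one_mul] at hdet
  refine ⟨M.toBlocks₁₂, ⟨M.toBlocks₂₂, hdet⟩, Subtype.ext ?_⟩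
  change _ = (fromBlocks 1 M.toBlocks₁₂ 0 M.toBlocks₂₂).submatrix _ _
  rw [← hM]
  simp [M, submatrix_submatrix]

end LinearAlgebra

noncomputable section

namespace PrimeTup

variable {S : PrimeTup} {d : ℕ}

instance : MeasurableAdd₂ (S.QS d) := ContinuousAdd.measurableMul₂

/-- The compact box `[-2,2]ᵈ × ∏ ℤ_pᵈ`. -/
def box (S : PrimeTup) (d : ℕ) : Set (S.QS d) :=
  {x | (∀ j, |x.1 j| ≤ 2) ∧ ∀ i j, ‖x.2 i j‖ ≤ 1}

lemma box_eq : S.box d = Metric.closedBall 0 2 ×ˢ Set.univ.pi fun i ↦ S.boxp d i := by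
  ext x
  simp [box, boxp, Set.mem_pi, pi_norm_le_iff_of_nonneg zero_le_two]

lemma isCompact_box : IsCompact (S.box d) := by
  rw [box_eq]
  exact (isCompact_closedBall _ _).prod (isCompact_univ_pi fun i ↦ isCompact_boxp i)

lemma exists_dz_sub_mem_unitBox (x : S.QS d) : ∃ v : Fin d → S.Zs, x - dz v ∈ S.unitBox d := by
  choose q hq hq' using fun j ↦ exists_approx (x.1 j) fun i ↦ x.2 i j
  exact ⟨q, hq, fun i j ↦ hq' j i⟩

/-- Minkowski's theorem for unimodular `S`-lattices, giving a unimodular lattice vector. -/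
lemma exists_unimodular_smul_dz_mem_box (hd : 1 ≤ d) (δ : S.G d) :
    ∃ v a : Fin d → S.Zs, a ⬝ᵥ v = 1 ∧ δ • dz v ∈ S.box d := by
  let E : Set (S.QS d) := Set.Icc 0 2 ×ˢ Set.univ.pi fun i ↦ S.boxp d i
  have hE : S.vol d E = 2 ^ d := by
    simp [E, vol_prod, volp_boxp, Real.volume_Icc_pi]
  have hEm : MeasurableSet E :=
    measurableSet_Icc.prod (MeasurableSet.univ_pi fun i ↦ (isCompact_boxp i).measurableSet)
  have hDm : MeasurableSet (S.unitBox d) := by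
    rw [unitBox_eq]
    exact measurableSet_Icc.prod (MeasurableSet.univ_pi fun i ↦ (isCompact_boxp i).measurableSet)
  let s : (Fin d → S.Zs) → Set (S.QS d) := fun v ↦ {y | δ • (y + dz v) ∈ E}
  have hs : ∀ v, MeasurableSet (s v) := fun v ↦
    ((measurable_add_const (dz v)).const_smul δ) hEm
  obtain ⟨v, v', hne, y, hy, hy'⟩ : ∃ v v', v ≠ v' ∧ (s v ∩ s v').Nonempty := by
    refine exists_nonempty_inter_of_measure_univ_lt_tsum_measure
      ((S.vol d).restrict (S.unitBox d)) (fun v ↦ (hs v).nullMeasurableSet) ?_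
    rw [Measure.restrict_apply_univ, vol_unitBox]
    calc (1 : ℝ≥0∞) < 2 ^ d := one_lt_pow₀ (by norm_num) (by omega)
      _ = S.vol d ((fun x ↦ δ • x) ⁻¹' E) := by
        rw [measure_preimage_smul, hE]
      _ ≤ S.vol d (⋃ v, (fun x ↦ x + -dz v) ⁻¹' (s v ∩ S.unitBox d)) := by
        refine measure_mono fun x hx ↦ Set.mem_iUnion.2 ?_
        obtain ⟨v, hv⟩ := exists_dz_sub_mem_unitBox x
        refine ⟨v, ?_, by simpa [sub_eq_add_neg] using hv⟩
        simpa [s] using hx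
      _ ≤ ∑' v, S.vol d ((fun x ↦ x + -dz v) ⁻¹' (s v ∩ S.unitBox d)) := measure_iUnion_le _
      _ = ∑' v, (S.vol d).restrict (S.unitBox d) (s v) := by
        refine tsum_congr fun v ↦ ?_
        rw [Measure.restrict_apply (hs v)]
        exact measure_preimage_add_right _ _ _
  have hw : v - v' ≠ 0 := sub_ne_zero.2 hne
  have hmem : δ • dz (v - v') ∈ S.box d := by
    have h1 : δ • dz (v - v') = δ • (y + dz v) - δ • (y + dz v') := by
      rw [dz_sub, ← smul_sub, add_sub_add_left_eq_sub]
    rw [h1]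
    constructor
    · intro j
      have h2 := And.intro (hy.1.1 j) (hy.1.2 j)
      have h3 := And.intro (hy'.1.1 j) (hy'.1.2 j)
      simp only [Pi.ofNat_apply] at h2 h3
      rw [Prod.fst_sub, Pi.sub_apply, abs_le]
      constructor <;> linarith [h2.1, h2.2, h3.1, h3.2]
    · intro i j
      rw [Prod.snd_sub, Pi.sub_apply, Pi.sub_apply, sub_eq_add_neg]
      refine (Padic.nonarchimedean _ _).trans (max_le (hy.2 i trivial j) ?_)
      rw [norm_neg]
      exact hy'.2 i trivial j
  obtain ⟨m, hm, w, a, hwm, haw⟩ := exists_unimodular hw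
  obtain ⟨n, hn, u, rfl⟩ := exists_unit_mul hm
  have hn1 : (1 : ℝ) ≤ n := by exact_mod_cast hn.1
  refine ⟨(u : S.Zs) • w, ((u⁻¹ : S.Zsˣ) : S.Zs) • a, ?_, ?_⟩
  · rw [smul_dotProduct, dotProduct_smul, smul_smul, haw]
    simp
  · have h1 : δ • dz (v - v') = S.ratSMul n (δ • dz ((u : S.Zs) • w)) := by
      rw [hwm, mul_comm, mul_smul]
      have : dz ((n : S.Zs) • (u : S.Zs) • w) = S.ratSMul n (dz ((u : S.Zs) • w)) := by
        ext <;> simp [dz, diag, ratSMul]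
      rw [this]
      ext i
      · simp [ratSMul, mulVec, dotProduct, Finset.mul_sum, mul_left_comm]
      · simp [ratSMul, mulVec, dotProduct, Finset.mul_sum, mul_left_comm]
    rw [h1] at hmem
    constructor
    · intro j
      have := hmem.1 j
      simp only [ratSMul, abs_mul, Rat.cast_natCast, Nat.abs_cast] at this
      nlinarith [abs_nonneg ((δ • dz ((u : S.Zs) • w)).1 j)]
    · intro i j
      have := hmem.2 i j
      have h2 : ‖(n : S.Qp i)‖ = 1 :=
        Padic.norm_natCast_eq_one_iff.2 ((Nat.Prime.coprime_iff_not_dvd (S.hp i)).2 (hn.2 i))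
      simpa [ratSMul, h2] using this

/-- The standard frame. -/
def frame (S : PrimeTup) (d k : ℕ) : Fin k → S.QS d := fun j ↦ dz (stdVec S.Zs d j)

lemma fst_dz_stdVec (j : ℕ) : (dz (stdVec S.Zs d j) : S.QS d).1 = stdVec ℝ d j := by
  ext i
  simp only [dz, diag, stdVec]
  split_ifs <;> simp

lemma snd_dz_stdVec (j : ℕ) (i : Fin S.s) :
    (dz (stdVec S.Zs d j) : S.QS d).2 i = stdVec (S.Qp i) d j := by
  ext l
  simp only [dz, diag, stdVec]
  split_ifs <;> simp

lemma exists_fix_frame_smul_mem_box {k : ℕ} (hk : k < d) {g : S.G d}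
    (hg : g • S.frame d k = S.frame d k) :
    ∃ u : SpecialLinearGroup (Fin d) S.Zs, S.toG d u • S.frame d k = S.frame d k ∧
      g • S.toG d u • dz (stdVec S.Zs d k) ∈ S.box d := by
  obtain ⟨n, rfl⟩ : ∃ n, d = k + (n + 1) := ⟨d - k - 1, by omega⟩
  have hfix : ∀ j < k, g • dz (stdVec S.Zs (k + (n + 1)) j) = dz (stdVec S.Zs (k + (n + 1)) j) :=
    fun j hj ↦ congrFun hg ⟨j, hj⟩
  obtain ⟨B₀, D₀, h₀⟩ := exists_eq_blockSL g.1 fun j hj ↦ by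
    have := congrArg Prod.fst (hfix j hj)
    rwa [smul_fst, fst_dz_stdVec] at this
  choose B D h using fun i ↦ exists_eq_blockSL (g.2 i) fun j hj ↦ by
    have := congrFun (congrArg Prod.snd (hfix j hj)) i
    rwa [smul_snd, snd_dz_stdVec] at this
  obtain ⟨γ, hγ⟩ : ∃ γ : SpecialLinearGroup (Fin (n + 1)) S.Zs,
      ((D₀, D) : S.G (n + 1)) • dz (γ.1 *ᵥ stdVec S.Zs (n + 1) 0) ∈ S.box (n + 1) := by
    rcases Nat.eq_zero_or_pos n with rfl | hn
    · refine ⟨1, ?_⟩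
      have h1 : ((D₀, D) : S.G (0 + 1)) = 1 := Subsingleton.elim (α := S.G 1) _ _
      have h2 : (1 : SpecialLinearGroup (Fin (0 + 1)) S.Zs).1 *ᵥ stdVec S.Zs (0 + 1) 0 =
        stdVec S.Zs (0 + 1) 0 := one_mulVec _
      rw [h1, one_smul, h2]
      constructor
      · intro j
        rw [fst_dz_stdVec]
        simp only [stdVec]
        split_ifs <;> norm_num
      · intro i j
        rw [snd_dz_stdVec]
        simp only [stdVec]
        split_ifs <;> simp
    · obtain ⟨v, a, hva, hv⟩ := exists_unimodular_smul_dz_mem_box (d := n + 1) (by omega) (D₀, D)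
      obtain ⟨γ, hγ⟩ := exists_SL_mulVec_eq (by omega) hva
      exact ⟨γ, by rwa [hγ]⟩
  set v := γ.1 *ᵥ stdVec S.Zs (n + 1) 0 with hv
  let z : S.QS k := (B₀ *ᵥ (dz v).1, fun i ↦ B i *ᵥ (dz v).2 i)
  obtain ⟨b, hb⟩ := exists_dz_sub_mem_unitBox z
  let u := blockSL (Matrix.of fun i j ↦ if j = 0 then -b i else 0) γ
  have hu : u.1 *ᵥ stdVec S.Zs (k + (n + 1)) k = Fin.append (-b) v := by
    rw [stdVec_append_right, blockSL_mulVec]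
    congr 1
    ext i
    simp [mulVec, dotProduct, stdVec]
  refine ⟨u, funext fun j ↦ ?_, ?_⟩
  · change S.toG _ u • dz (stdVec S.Zs (k + (n + 1)) j) = dz (stdVec S.Zs (k + (n + 1)) j)
    rw [toG_smul_dz, blockSL_mulVec_stdVec _ _ j.2]
  · rw [toG_smul_dz, hu]
    have h1 : (g • dz (Fin.append (-b) v) : S.QS (k + (n + 1))).1 =
        Fin.append (z.1 - (dz b).1) (D₀.1 *ᵥ (dz v).1) := by
      rw [smul_fst, h₀]
      have : (dz (Fin.append (-b) v) : S.QS (k + (n + 1))).1 =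
          Fin.append (-(dz b : S.QS k).1) (dz v : S.QS (n + 1)).1 := by
        ext i
        refine Fin.addCases (fun i ↦ ?_) (fun i ↦ ?_) i <;> simp [dz, diag]
      rw [this, blockSL_mulVec, sub_eq_neg_add]
    have h2 : ∀ i, (g • dz (Fin.append (-b) v) : S.QS (k + (n + 1))).2 i =
        Fin.append (z.2 i - (dz b).2 i) ((D i).1 *ᵥ (dz v).2 i) := fun i ↦ by
      rw [smul_snd, h]
      have : (dz (Fin.append (-b) v) : S.QS (k + (n + 1))).2 i =
          Fin.append (-(dz b : S.QS k).2 i) ((dz v : S.QS (n + 1)).2 i) := by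
        ext i
        refine Fin.addCases (fun i ↦ ?_) (fun i ↦ ?_) i <;> simp [dz, diag]
      rw [this, blockSL_mulVec, sub_eq_neg_add]
    constructor
    · intro j
      rw [h1]
      refine Fin.addCases (fun j ↦ ?_) (fun j ↦ ?_) j
      · rw [Fin.append_left, abs_le]
        have := hb.1 j
        exact ⟨by linarith [this.1, show (0 : ℝ) ≤ (z.1 - (dz b).1) j from this.1],
          by linarith [show (z.1 - (dz b).1) j ≤ 1 from this.2]⟩
      · rw [Fin.append_right]
        exact hγ.1 j
    · intro i j
      rw [h2]
      refine Fin.addCases (fun j ↦ ?_) (fun j ↦ ?_) j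
      · rw [Fin.append_left]
        exact hb.2 i j
      · rw [Fin.append_right]
        exact hγ.2 i j

end PrimeTup

end

/-- A set meeting almost no point of each member of a family of curves is null. -/
lemma measure_eq_zero_of_translates {T Y : Type*} [MeasurableSpace T] [AddCommGroup Y]
    [MeasurableSpace Y] [MeasurableAdd₂ Y] (m : Measure T) [SFinite m] [NeZero m] (l : Measure Y)
    [SFinite l] [l.IsAddLeftInvariant] {B : Set Y} (hB : MeasurableSet B) {τ : T → Y}
    (hτ : Measurable τ) (h : ∀ y, m {t | τ t + y ∈ B} = 0) : l B = 0 := by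
  have hm : MeasurableSet {p : T × Y | τ p.1 + p.2 ∈ B} :=
    ((hτ.comp measurable_fst).add measurable_snd) hB
  have h1 : (m.prod l) {p : T × Y | τ p.1 + p.2 ∈ B} = 0 := by
    rw [Measure.prod_apply_symm hm]
    exact lintegral_eq_zero_of_ae_eq_zero (ae_of_all _ fun y ↦ h y)
  rw [Measure.prod_apply hm] at h1
  have h2 : ∀ t, l (Prod.mk t ⁻¹' {p : T × Y | τ p.1 + p.2 ∈ B}) = l B := fun t ↦
    measure_preimage_add l (τ t) B
  simp only [h2, lintegral_const, mul_eq_zero] at h1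
  exact h1.resolve_right (NeZero.ne _ ∘ Measure.measure_univ_eq_zero.1)

section LinearAlgebra

variable {F : Type*} [Field F]

lemma finite_det_eq_zero {k : ℕ} (M : Matrix (Fin k) (Fin k) F) :
    {t : F | (t • (1 : Matrix (Fin k) (Fin k) F) + M).det = 0}.Finite := by
  refine Set.Finite.subset (Polynomial.finite_setOfPred_isRoot (p := (-M).charpoly)
    (Matrix.charpoly_monic _).ne_zero) fun t ht ↦ ?_
  rw [Set.mem_ofPred_eq, Polynomial.IsRoot.def, Matrix.eval_charpoly, sub_neg_eq_add]
  rw [Set.mem_ofPred_eq] at ht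
  rwa [Matrix.scalar_apply, ← Matrix.smul_one_eq_diagonal]

/-- The special linear group acts transitively on short independent families. -/
lemma exists_SL_mulVec_stdVec {k n : ℕ} {y : Fin k → Fin (k + (n + 1)) → F}
    (hy : LinearIndependent F y) :
    ∃ g : SpecialLinearGroup (Fin (k + (n + 1))) F,
      ∀ j : Fin k, g.1 *ᵥ stdVec F (k + (n + 1)) j = y j := by
  let b := Module.Basis.sumExtend hy
  have : Fintype (Module.Basis.sumExtendIndex hy) := by
    have := Module.Finite.finite_basis b
    have : Finite (Module.Basis.sumExtendIndex hy) := Finite.sum_right (Fin k)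
    exact Fintype.ofFinite _
  have hcard : Fintype.card (Module.Basis.sumExtendIndex hy) = n + 1 := by
    have := Module.finrank_eq_card_basis b
    rw [Module.finrank_fin_fun, Fintype.card_sum, Fintype.card_fin] at this
    omega
  let e : Fin k ⊕ Module.Basis.sumExtendIndex hy ≃ Fin (k + (n + 1)) :=
    ((Equiv.refl _).sumCongr (Fintype.equivFinOfCardEq hcard)).trans finSumFinEquiv
  let B := b.reindex e
  have hB : ∀ j : Fin k, B (Fin.castAdd _ j) = y j := fun j ↦ by
    have : e.symm (Fin.castAdd _ j) = Sum.inl j := by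
      rw [Equiv.symm_apply_eq]
      simp [e]
    rw [Module.Basis.reindex_apply, this]
    simp only [b, Module.Basis.sumExtend, Module.Basis.reindex_apply, Module.Basis.coe_extend]
    rfl
  let M := (Pi.basisFun F (Fin (k + (n + 1)))).toMatrix B
  have hM : M.det ≠ 0 := by
    have := (Pi.basisFun F (Fin (k + (n + 1)))).invertibleToMatrix B
    exact ((Matrix.isUnit_iff_isUnit_det _).1 (isUnit_of_invertible M)).ne_zero
  let D : Matrix (Fin (k + (n + 1))) (Fin (k + (n + 1))) F :=
    diagonal (Function.update 1 (Fin.last (k + n)) M.det⁻¹)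
  refine ⟨⟨M * D, ?_⟩, fun j ↦ ?_⟩
  · rw [det_mul, det_diagonal, Finset.prod_update_of_mem (Finset.mem_univ _)]
    simp [hM]
  · change (M * D) *ᵥ _ = _
    have hj : stdVec F (k + (n + 1)) j = Pi.single (Fin.castAdd _ j) 1 :=
      stdVec_eq_single (Fin.castAdd (n + 1) j)
    have hne : Fin.castAdd (n + 1) j ≠ Fin.last (k + n) := by
      rw [Ne, Fin.ext_iff]
      simp
      omega
    rw [hj, ← mulVec_mulVec]
    have h0 : D *ᵥ Pi.single (Fin.castAdd _ j) 1 = Pi.single (Fin.castAdd _ j) 1 := by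
      simp only [D, diagonal_mulVec_single]
      rw [Function.update_of_ne hne]
      simp
    rw [h0, mulVec_single_one]
    ext i
    simp [M, Module.Basis.toMatrix_apply, hB]

lemma linearIndependent_of_det_ne_zero {k d : ℕ} (h : k ≤ d) {y : Fin k → Fin d → F}
    (hy : (Matrix.of fun i j ↦ y i (Fin.castLE h j)).det ≠ 0) : LinearIndependent F y := by
  have h1 := Matrix.linearIndependent_rows_of_det_ne_zero hy
  exact LinearIndependent.of_comp (LinearMap.funLeft F F (Fin.castLE h)) h1

end LinearAlgebra

noncomputable section

namespace PrimeTup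

variable {S : PrimeTup} {d k : ℕ}

/-- The volume on `k`-tuples of vectors. -/
def volk (S : PrimeTup) (d k : ℕ) : Measure (Fin k → S.QS d) := Measure.pi fun _ ↦ S.vol d

instance : (S.volk d k).IsAddHaarMeasure := Measure.pi.isAddHaarMeasure _

instance : SigmaFinite (S.volk d k) := Measure.pi.sigmaFinite _

instance : SMulInvariantMeasure (S.G d) (Fin k → S.QS d) (S.volk d k) := by
  refine ⟨fun g s hs ↦ ?_⟩
  have h := measurePreserving_pi (fun _ : Fin k ↦ S.vol d) (fun _ ↦ S.vol d)
    fun _ ↦ measurePreserving_smul g (S.vol d)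
  exact h.measure_preimage hs.nullMeasurableSet

instance : MeasurableAdd₂ (Fin k → S.QS d) := Pi.measurableAdd₂

lemma measurable_fst_apply (i : Fin k) (j : Fin d) :
    Measurable fun y : Fin k → S.QS d ↦ (y i).1 j :=
  (measurable_pi_apply j).comp (measurable_fst.comp (measurable_pi_apply i))

lemma measurable_snd_apply (l : Fin S.s) (i : Fin k) (j : Fin d) :
    Measurable fun y : Fin k → S.QS d ↦ (y i).2 l j :=
  (measurable_pi_apply j).comp
    ((measurable_pi_apply l).comp (measurable_snd.comp (measurable_pi_apply i)))

lemma volk_det_fst_eq_zero (h : k ≤ d) :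
    S.volk d k {y | (Matrix.of fun i j ↦ (y i).1 (Fin.castLE h j)).det = 0} = 0 := by
  let τ : ℝ → Fin k → S.QS d := fun t j ↦ (t • stdVec ℝ d j, 0)
  have hτ : Measurable τ := measurable_pi_lambda _ fun j ↦
    Measurable.prodMk (by fun_prop) measurable_const
  refine measure_eq_zero_of_translates (volume : Measure ℝ) _ ?_ hτ fun y ↦ ?_
  · refine measurableSet_eq_fun ?_ measurable_const
    simp only [Matrix.det_apply]
    exact Finset.measurable_sum _ fun σ _ ↦ Measurable.const_smul
      (Finset.measurable_prod _ fun i _ ↦ measurable_fst_apply _ _) _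
  · refine Set.Finite.measure_zero (Set.Finite.subset (finite_det_eq_zero
      (Matrix.of fun i j ↦ (y i).1 (Fin.castLE h j))) fun t ht ↦ ?_) _
    rw [Set.mem_ofPred_eq] at ht ⊢
    rw [← ht]
    congr 1
    ext i j
    simp [τ, stdVec, one_apply, Fin.ext_iff, eq_comm]

instance (l : Fin S.s) : MeasurableMul₂ (S.Qp l) := ContinuousMul.measurableMul₂

instance (l : Fin S.s) : MeasurableAdd₂ (S.Qp l) := ContinuousAdd.measurableMul₂

lemma volk_det_snd_eq_zero (h : k ≤ d) (l : Fin S.s) :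
    S.volk d k {y | (Matrix.of fun i j ↦ (y i).2 l (Fin.castLE h j)).det = 0} = 0 := by
  let τ : S.Qp l → Fin k → S.QS d := fun t j ↦ (0, Pi.single l (t • stdVec (S.Qp l) d j))
  have hτ : Measurable τ := measurable_pi_lambda _ fun j ↦
    Measurable.prodMk measurable_const (by
      refine Continuous.measurable ?_
      refine (continuous_single l).comp ?_
      fun_prop)
  refine measure_eq_zero_of_translates (Measure.addHaar : Measure (S.Qp l)) _ ?_ hτ fun y ↦ ?_
  · refine measurableSet_eq_fun ?_ measurable_const
    simp only [Matrix.det_apply]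
    exact Finset.measurable_sum _ fun σ _ ↦ Measurable.const_smul
      (Finset.measurable_prod _ fun i _ ↦ measurable_snd_apply _ _ _) _
  · refine Set.Finite.measure_zero (Set.Finite.subset (finite_det_eq_zero
      (Matrix.of fun i j ↦ (y i).2 l (Fin.castLE h j))) fun t ht ↦ ?_) _
    rw [Set.mem_ofPred_eq] at ht ⊢
    rw [← ht]
    congr 1
    ext i j
    simp [τ, stdVec, one_apply, Fin.ext_iff, eq_comm]

/-- Almost every short tuple of vectors lies in the orbit of the standard frame. -/
lemma volk_orbit_compl (h : k < d) :
    S.volk d k (Set.range fun g : S.G d ↦ g • S.frame d k)ᶜ = 0 := by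
  refine measure_mono_null (t :=
    {y | (Matrix.of fun i j ↦ (y i).1 (Fin.castLE h.le j)).det = 0} ∪
    ⋃ l, {y | (Matrix.of fun i j ↦ (y i).2 l (Fin.castLE h.le j)).det = 0}) ?_
    (measure_union_null (volk_det_fst_eq_zero _)
      (measure_iUnion_null fun l ↦ volk_det_snd_eq_zero _ l))
  intro y hy
  by_contra hc
  simp only [Set.mem_union, Set.mem_iUnion, Set.mem_ofPred_eq, not_or, not_exists] at hc
  apply hy
  obtain ⟨n, rfl⟩ : ∃ n, d = k + (n + 1) := ⟨d - k - 1, by omega⟩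
  obtain ⟨g₀, h₀⟩ := exists_SL_mulVec_stdVec (linearIndependent_of_det_ne_zero _ hc.1)
  choose g hg using fun l ↦ exists_SL_mulVec_stdVec (linearIndependent_of_det_ne_zero _ (hc.2 l))
  refine ⟨(g₀, g), funext fun j ↦ Prod.ext ?_ (funext fun l ↦ ?_)⟩
  · change g₀.1 *ᵥ (dz _ : S.QS _).1 = _
    rw [fst_dz_stdVec, h₀]
  · change (g l).1 *ᵥ (dz _ : S.QS _).2 l = _
    rw [snd_dz_stdVec, hg]

end PrimeTup

end

noncomputable section

open scoped Pointwise

namespace PrimeTup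

variable {S : PrimeTup} {d k : ℕ}

/-- The elements of `G_d` all of whose matrix entries lie in the box. -/
def boxG (S : PrimeTup) (d : ℕ) : Set (S.G d) :=
  {g | (∀ i j, |g.1 i j| ≤ 2) ∧ ∀ l i j, ‖g.2 l i j‖ ≤ 1}

lemma isCompact_boxG : IsCompact (S.boxG d) := by
  have h1 : IsCompact {g : SpecialLinearGroup (Fin d) ℝ | ∀ i j, |g i j| ≤ 2} := by
    have h : IsCompact {M : Matrix (Fin d) (Fin d) ℝ | ∀ i j, |M i j| ≤ 2} := by
      have := isCompact_univ_pi fun _ : Fin d ↦ isCompact_univ_pi fun _ : Fin d ↦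
        isCompact_closedBall (0 : ℝ) 2
      have he : {M : Fin d → Fin d → ℝ | ∀ i j, |M i j| ≤ 2} =
          Set.univ.pi fun _ ↦ Set.univ.pi fun _ ↦ Metric.closedBall (0 : ℝ) 2 := by
        ext M
        simp
      rw [← he] at this
      exact this
    exact SpecialLinearGroup.isClosedEmbedding_val'.isCompact_preimage h
  have h2 : ∀ l, IsCompact {g : SpecialLinearGroup (Fin d) (S.Qp l) | ∀ i j, ‖g i j‖ ≤ 1} := by
    intro l
    have h : IsCompact {M : Matrix (Fin d) (Fin d) (S.Qp l) | ∀ i j, ‖M i j‖ ≤ 1} := by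
      have := isCompact_univ_pi fun _ : Fin d ↦ isCompact_univ_pi fun _ : Fin d ↦
        isCompact_closedBall (0 : S.Qp l) 1
      have he : {M : Fin d → Fin d → S.Qp l | ∀ i j, ‖M i j‖ ≤ 1} =
          Set.univ.pi fun _ ↦ Set.univ.pi fun _ ↦ Metric.closedBall (0 : S.Qp l) 1 := by
        ext M
        simp
      rw [← he] at this
      exact this
    exact SpecialLinearGroup.isClosedEmbedding_val'.isCompact_preimage h
  convert h1.prod (isCompact_univ_pi h2) using 1
  ext g
  simp [boxG, Set.mem_pi]

lemma mem_boxG_iff {g : S.G d} :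
    g ∈ S.boxG d ↔ ∀ j : Fin d, g • dz (stdVec S.Zs d j) ∈ S.box d := by
  have h1 : ∀ i j, (g • (dz (stdVec S.Zs d (j : Fin d)) : S.QS d)).1 i = g.1 i j := fun i j ↦ by
    rw [smul_fst, fst_dz_stdVec, mulVec_stdVec]; rfl
  have h2 : ∀ l i j, (g • (dz (stdVec S.Zs d (j : Fin d)) : S.QS d)).2 l i = g.2 l i j :=
    fun l i j ↦ by rw [smul_snd, snd_dz_stdVec, mulVec_stdVec]; rfl
  simp only [boxG, box, Set.mem_ofPred_eq, h1, h2]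
  exact ⟨fun h j ↦ ⟨fun i ↦ h.1 i j, fun l i ↦ h.2 l i j⟩,
    fun h ↦ ⟨fun i j ↦ (h j).1 i, fun l i j ↦ (h j).2 l i⟩⟩

lemma dz_stdVec_mem_box (j : ℕ) : (dz (stdVec S.Zs d j) : S.QS d) ∈ S.box d := by
  refine ⟨fun i ↦ ?_, fun l i ↦ ?_⟩
  · rw [fst_dz_stdVec, stdVec]
    split_ifs <;> simp
  · rw [snd_dz_stdVec, stdVec]
    split_ifs <;> simp

lemma finite_toG_mem_compact {K : Set (S.G d)} (hK : IsCompact K) :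
    {γ : SpecialLinearGroup (Fin d) S.Zs | S.toG d γ ∈ K}.Finite := by
  have h1 : ∀ i j, ∃ B : ℝ, ∀ g ∈ K, ‖g.1 i j‖ ≤ B := fun i j ↦
    hK.exists_bound_of_continuousOn (f := fun g : S.G d ↦ g.1 i j)
      (((SpecialLinearGroup.continuous_val'.comp continuous_fst).matrix_elem i j).continuousOn)
  have h2 : ∀ i j l, ∃ B : ℝ, ∀ g ∈ K, ‖g.2 l i j‖ ≤ B := fun i j l ↦
    hK.exists_bound_of_continuousOn (f := fun g : S.G d ↦ g.2 l i j)
      (((SpecialLinearGroup.continuous_val'.comp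
        ((continuous_apply l).comp continuous_snd)).matrix_elem i j).continuousOn)
  choose B hB using h1
  choose C hC using h2
  have hfin : (Set.univ.pi fun i ↦ Set.univ.pi fun j ↦
      {q : S.Zs | |((q : ℚ) : ℝ)| ≤ B i j ∧ ∀ l, ‖((q : ℚ) : S.Qp l)‖ ≤ C i j l}).Finite :=
    Set.Finite.pi fun i ↦ Set.Finite.pi fun j ↦ finite_Zs_bounded (B i j) (C i j)
  refine Set.Finite.of_finite_image (f := fun γ ↦ (γ.1 : Fin d → Fin d → S.Zs))
    (hfin.subset ?_) fun _ _ _ _ h ↦ Subtype.ext h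
  rintro _ ⟨γ, hγ, rfl⟩ i - j -
  exact ⟨hB i j _ hγ, fun l ↦ hC i j l _ hγ⟩

lemma Gamma_mul_mem {γ : S.G d} (hγ : γ ∈ S.Gamma d) {t : S.G d}
    (ht : t ∈ (S.Gamma d : Set (S.G d))) : γ • t ∈ (S.Gamma d : Set (S.G d)) := mul_mem hγ ht

instance : Countable (S.Gamma d : Set (S.G d)) := inferInstanceAs (Countable (S.Gamma d))

instance : MeasurableMul₂ (S.G d) := ContinuousMul.measurableMul₂

lemma siegelMeasure_Gamma_ne_top (μ : Measure (S.G d ⧸ S.Gamma d)) [IsFiniteMeasure μ]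
    {K : Set (S.G d)} (hK : IsCompact K) :
    siegelMeasure (S.Gamma d : Set (S.G d)) μ K ≠ ∞ := by
  have hfin := finite_toG_mem_compact (hK.inv.mul hK)
  have : Finite {γ : SpecialLinearGroup (Fin d) S.Zs | S.toG d γ ∈ K⁻¹ * K} := hfin
  refine siegelMeasure_ne_top_of_finite (fun γ hγ t ht ↦ Gamma_mul_mem hγ ht) μ hK.measurableSet
    (ι := {γ : SpecialLinearGroup (Fin d) S.Zs | S.toG d γ ∈ K⁻¹ * K})
    (fun i t ↦ t * S.toG d i) fun g t ht hgt t' ht' hgt' ↦ ?_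
  obtain ⟨γ, hγ⟩ : t⁻¹ * t' ∈ S.Gamma d := mul_mem (inv_mem ht) ht'
  refine ⟨⟨γ, ?_⟩, ?_⟩
  · rw [Set.mem_ofPred_eq, hγ]
    refine ⟨(g • t)⁻¹, Set.inv_mem_inv.2 hgt, g • t', hgt', ?_⟩
    simp [mul_assoc]
  · change t' = t * S.toG d γ
    rw [hγ, mul_inv_cancel_left]

instance : BorelSpace (S.QS d) := Prod.borelSpace

instance : BorelSpace (Fin k → S.QS d) := Pi.borelSpace

/-- Tuples of lattice vectors that extend to a lattice basis of covolume one. -/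
def primFrames (S : PrimeTup) (d k : ℕ) : Set (Fin k → S.QS d) :=
  Set.range fun γ : SpecialLinearGroup (Fin d) S.Zs ↦ S.toG d γ • S.frame d k

instance : Countable (S.primFrames d k) := (Set.countable_range _).to_subtype

lemma smul_mem_primFrames (γ : S.G d) (hγ : γ ∈ S.Gamma d) (t : Fin k → S.QS d)
    (ht : t ∈ S.primFrames d k) : γ • t ∈ S.primFrames d k := by
  obtain ⟨γ, rfl⟩ := hγ
  obtain ⟨δ, rfl⟩ := ht
  exact ⟨γ * δ, by simp [mul_smul]⟩

lemma smul_primFrames_subset (g : S.G d) (t : Fin k → S.QS d) (ht : t ∈ S.primFrames d k) :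
    g • t ∈ Set.range fun g : S.G d ↦ g • S.frame d k := by
  obtain ⟨δ, rfl⟩ := ht
  exact ⟨g * S.toG d δ, by simp [mul_smul]⟩

lemma isCompact_smul_frame {W : Set (S.G d)} (hW : IsCompact W) :
    IsCompact ((fun g : S.G d ↦ g • S.frame d k) '' W) :=
  hW.image (continuous_id.smul continuous_const)

lemma measurableSet_orbit :
    MeasurableSet (Set.range fun g : S.G d ↦ g • S.frame d k) := by
  rw [← Set.image_univ, ← iUnion_compactCovering, Set.image_iUnion]
  exact .iUnion fun n ↦ (isCompact_smul_frame (isCompact_compactCovering _ n)).measurableSet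

lemma orbit_homogeneous {x y : Fin k → S.QS d}
    (hx : x ∈ Set.range fun g : S.G d ↦ g • S.frame d k)
    (hy : y ∈ Set.range fun g : S.G d ↦ g • S.frame d k) : ∃ g : S.G d, g • x = y := by
  obtain ⟨a, rfl⟩ := hx
  obtain ⟨b, rfl⟩ := hy
  exact ⟨b * a⁻¹, by simp [mul_smul]⟩

/-- An invariant σ-finite measure carried by the orbit of a frame is a multiple of the volume. -/
lemma eq_smul_volk (hk : k < d) (ν : Measure (Fin k → S.QS d)) [SigmaFinite ν]
    [SMulInvariantMeasure (S.G d) (Fin k → S.QS d) ν]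
    (hν : ν (Set.range fun g : S.G d ↦ g • S.frame d k)ᶜ = 0) :
    ∃ c : ℝ≥0∞, c ≠ ∞ ∧ ν = c • S.volk d k :=
  exists_eq_smul_of_homogeneous (Measure.haar : Measure (S.G d)) (NeZero.ne _)
    (fun _ hx _ hy ↦ orbit_homogeneous hx hy) ν (S.volk d k) hν (volk_orbit_compl hk) (NeZero.ne _)

variable (μ : Measure (S.G d ⧸ S.Gamma d))

lemma siegelMeasure_primFrames_eq (hk : k < d) [SMulInvariantMeasure (S.G d) (S.G d ⧸ S.Gamma d) μ]
    {W : Set (S.G d)} (hW : W ∈ nhds 1) (hWc : IsCompact W)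
    (h : siegelMeasure (S.primFrames d k) μ ((fun g : S.G d ↦ g • S.frame d k) '' W) ≠ ∞) :
    ∃ c : ℝ≥0∞, c ≠ ∞ ∧ siegelMeasure (S.primFrames d k) μ = c • S.volk d k := by
  have hinv := smulInvariantMeasure_siegelMeasure (Γ := S.Gamma d) (smul_mem_primFrames (k := k)) μ
  have hnull : siegelMeasure (S.primFrames d k) μ
      (Set.range fun g : S.G d ↦ g • S.frame d k)ᶜ = 0 :=
    siegelMeasure_eq_zero smul_mem_primFrames μ measurableSet_orbit.compl
      fun g t ht hc ↦ hc (smul_primFrames_subset g t ht)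
  have := sigmaFinite_of_nhds _ (S.frame d k) hnull hW
    (isCompact_smul_frame hWc).measurableSet (fun g hg ↦ Set.mem_image_of_mem _ hg) h
  exact eq_smul_volk hk _ hnull

lemma siegelMeasure_frame_le (hk : k < d) {W : Set (S.G d)} (hWc : IsCompact W)
    {Z : Type*} [MeasurableSpace Z] [MulAction (S.G d) Z] [MeasurableSMul (S.G d) Z]
    {T' : Set Z} [Countable T'] (hT' : ∀ γ ∈ S.Gamma d, ∀ t ∈ T', γ • t ∈ T')
    {U' : Set Z} (hU' : MeasurableSet U') (π : Z → Fin k → S.QS d) (ζ : S.G d → Z)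
    (hζ : ∀ g γ, ζ (g * γ) = g • ζ γ)
    (hζT : ∀ γ ∈ S.Gamma d, ζ γ ∈ T') (hπ : ∀ g, π (ζ g) = g • S.frame d k)
    (hU : ∀ h ∈ W, ∀ g : S.G d, g • S.frame d k = S.frame d k →
      g • dz (stdVec S.Zs d k) ∈ S.box d → ζ (h * g) ∈ U') :
    siegelMeasure (S.primFrames d k) μ ((fun g : S.G d ↦ g • S.frame d k) '' W) ≤
      siegelMeasure T' μ U' := by
  refine siegelMeasure_le_of_lift smul_mem_primFrames hT' μ
    (isCompact_smul_frame hWc).measurableSet hU' π ?_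
  rintro g _ ⟨γ, rfl⟩ ⟨h, hh, hg⟩
  have hfix : (h⁻¹ * g * S.toG d γ) • S.frame d k = S.frame d k := by
    rw [mul_smul, mul_smul, ← hg, inv_smul_smul]
  obtain ⟨u, hu, hbox⟩ := exists_fix_frame_smul_mem_box hk hfix
  refine ⟨ζ (S.toG d (γ * u)), hζT _ ⟨_, rfl⟩, ?_, ?_⟩
  · rw [hπ, map_mul, mul_smul, hu]
  · have := hU h hh (h⁻¹ * g * S.toG d γ * S.toG d u) (by rw [mul_smul, hu, hfix])
      (by rwa [mul_smul])
    rw [← hζ]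
    convert this using 2
    simp [mul_assoc]

lemma siegelMeasure_frame_ne_top_base [IsFiniteMeasure μ] (hk : k + 1 = d) {W : Set (S.G d)}
    (hWc : IsCompact W) :
    siegelMeasure (S.primFrames d k) μ ((fun g : S.G d ↦ g • S.frame d k) '' W) ≠ ∞ := by
  have hK : IsCompact (W * S.boxG d) := hWc.mul isCompact_boxG
  refine ne_top_of_le_ne_top (siegelMeasure_Gamma_ne_top μ hK)
    (siegelMeasure_frame_le μ (by omega) hWc (fun γ hγ t ht ↦ Gamma_mul_mem hγ ht)
      hK.measurableSet (fun g ↦ g • S.frame d k) id (fun _ _ ↦ rfl) (fun _ h ↦ h) (fun _ ↦ rfl)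
      fun h hh g hg hbox ↦ Set.mul_mem_mul hh (mem_boxG_iff.2 fun j ↦ ?_))
  rcases Nat.lt_succ_iff_lt_or_eq.1 (hk ▸ j.2 : j.1 < k + 1) with hj | hj
  · have := congrFun hg ⟨j, hj⟩
    change g • dz (stdVec S.Zs d j) = dz (stdVec S.Zs d j) at this
    rw [this]
    exact dz_stdVec_mem_box _
  · rwa [hj]

lemma siegelMeasure_frame_ne_top [IsFiniteMeasure μ]
    [SMulInvariantMeasure (S.G d) (S.G d ⧸ S.Gamma d) μ] {W : Set (S.G d)}
    (hW : W ∈ nhds 1) (hWc : IsCompact W) (n : ℕ) (hk : k + n + 1 = d) :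
    siegelMeasure (S.primFrames d k) μ ((fun g : S.G d ↦ g • S.frame d k) '' W) ≠ ∞ := by
  induction n generalizing k with
  | zero => exact siegelMeasure_frame_ne_top_base μ hk hWc
  | succ n ih =>
    obtain ⟨c, hc, h⟩ := siegelMeasure_primFrames_eq μ (by omega) hW hWc (ih (k := k + 1) (by omega))
    have hWB : IsCompact (W • S.box d) := hWc.smul_set isCompact_box
    have hK : IsCompact ((fun p : (Fin k → S.QS d) × S.QS d ↦
        (Fin.snoc p.1 p.2 : Fin (k + 1) → S.QS d)) ''
        (((fun g : S.G d ↦ g • S.frame d k) '' W) ×ˢ (W • S.box d))) :=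
      ((isCompact_smul_frame hWc).prod hWB).image (Continuous.finSnoc (A := fun _ ↦ S.QS d) continuous_fst continuous_snd)
    refine ne_top_of_le_ne_top ?_ (siegelMeasure_frame_le μ (by omega) hWc smul_mem_primFrames
      hK.measurableSet (fun y ↦ Fin.init y) (fun g ↦ g • S.frame d (k + 1)) ?_ ?_ (fun _ ↦ rfl)
      fun h hh g hg hbox ↦ ?_)
    · rw [h, Measure.smul_apply, smul_eq_mul]
      exact ENNReal.mul_ne_top hc hK.measure_lt_top.ne
    · intro g γ
      exact mul_smul _ _ _
    · rintro _ ⟨γ, rfl⟩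
      exact ⟨γ, rfl⟩
    · refine ⟨(Fin.init ((h * g) • S.frame d (k + 1)), ((h * g) • S.frame d (k + 1)) (Fin.last k)),
        ⟨⟨h, hh, ?_⟩, ?_⟩, Fin.snoc_init_self (α := fun _ ↦ S.QS d) ((h * g) • S.frame d (k + 1))⟩
      · change h • S.frame d k = (h * g) • S.frame d k
        rw [mul_smul, hg]
      · change (h * g) • dz (stdVec S.Zs d k) ∈ _
        rw [mul_smul]
        exact Set.smul_mem_smul hh hbox

/-- Siegel's mean value formula for short primitive tuples, up to a constant. -/
lemma exists_siegelMeasure_primFrames_eq (hk : k < d) [IsFiniteMeasure μ]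
    [SMulInvariantMeasure (S.G d) (S.G d ⧸ S.Gamma d) μ] :
    ∃ c : ℝ≥0∞, c ≠ ∞ ∧ siegelMeasure (S.primFrames d k) μ = c • S.volk d k := by
  obtain ⟨W, hWc, hW⟩ := exists_compact_mem_nhds (1 : S.G d)
  exact siegelMeasure_primFrames_eq μ hk hW hWc
    (siegelMeasure_frame_ne_top μ hW hWc (d - k - 1) (by omega))

instance [IsFiniteMeasure μ] [SMulInvariantMeasure (S.G d) (S.G d ⧸ S.Gamma d) μ] :
    SigmaFinite (siegelMeasure (S.Gamma d : Set (S.G d)) μ) := by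
  obtain ⟨W, hWc, hW⟩ := exists_compact_mem_nhds (1 : S.G d)
  have := smulInvariantMeasure_siegelMeasure (Γ := S.Gamma d)
    (T := (S.Gamma d : Set (S.G d))) (fun γ hγ t ht ↦ Gamma_mul_mem hγ ht) μ
  refine sigmaFinite_of_nhds _ (1 : S.G d) ?_ hW hWc.measurableSet (by simp)
    (siegelMeasure_Gamma_ne_top μ hWc)
  simp

instance [IsFiniteMeasure μ] [SMulInvariantMeasure (S.G d) (S.G d ⧸ S.Gamma d) μ] :
    ErgodicSMul (S.G d) (S.G d ⧸ S.Gamma d) μ := ergodicSMul_quotient μ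

end PrimeTup

end

noncomputable section

namespace PrimeTup

variable {S : PrimeTup} {d k : ℕ}

/-- Residues of `S`-integers modulo an integer prime to `S`. -/
lemma exists_residue {m : ℕ} (hm : m ∈ S.NS) (x : S.Zs) : ∃ a < m, ∃ b : S.Zs, x = a + m * b := by
  have hm0 : (0 : ℤ) < m := by exact_mod_cast hm.1
  have hcop : IsCoprime ((x : ℚ).den : ℤ) (m : ℤ) := by
    rw [Nat.isCoprime_iff_coprime]
    refine Nat.coprime_of_dvd fun l hl h1 h2 ↦ ?_
    obtain ⟨i, rfl⟩ := exists_eq_of_dvd_den x.2 hl h1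
    exact hm.2 i h2
  obtain ⟨u, v, huv⟩ := hcop
  let c : ℤ := (x : ℚ).num * u
  refine ⟨(c % m).toNat, ?_, (c / m : ℤ) + ((x : ℚ).num * v : ℤ) * ⟨_, inv_den_mem x.2⟩, ?_⟩
  · have := Int.emod_lt_of_pos c hm0
    have := Int.emod_nonneg c hm0.ne'
    omega
  · have h1 : ((c % m).toNat : ℤ) + m * (c / m) = c := by
      rw [Int.toNat_of_nonneg (Int.emod_nonneg c hm0.ne')]
      exact Int.emod_add_mul_ediv c m
    have h2 : (((c % m).toNat : ℕ) : ℚ) + m * ((c / m : ℤ) : ℚ) = (x : ℚ).num * u := by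
      exact_mod_cast h1
    have h3 : (u : ℚ) * (x : ℚ).den + v * m = 1 := by exact_mod_cast huv
    have hD : ((x : ℚ).den : ℚ) ≠ 0 := by exact_mod_cast (x : ℚ).den_ne_zero
    have h4 : (x : ℚ).num = (x : ℚ) * (x : ℚ).den := (Rat.mul_den_eq_num _).symm
    ext
    push_cast
    rw [mul_add, ← add_assoc, h2]
    generalize ((x : ℚ).den : ℚ) = D at *
    rw [h4]
    field_simp
    linear_combination -(x : ℚ) * h3

lemma exists_pair_eq (hd : 3 ≤ d) (γ : SpecialLinearGroup (Fin d) S.Zs) (w : Fin d → S.Zs) :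
    (∃ q : S.Zs, w = q • γ.1 *ᵥ stdVec S.Zs d 0) ∨
      ∃ m ∈ S.NS, ∃ a < m, ∃ δ : SpecialLinearGroup (Fin d) S.Zs,
        δ.1 *ᵥ stdVec S.Zs d 0 = γ.1 *ᵥ stdVec S.Zs d 0 ∧
        w = (a : S.Zs) • δ.1 *ᵥ stdVec S.Zs d 0 + (m : S.Zs) • δ.1 *ᵥ stdVec S.Zs d 1 := by
  obtain ⟨n, rfl⟩ : ∃ n, d = 1 + (n + 2) := ⟨d - 3, by omega⟩
  let x := (γ⁻¹).1 *ᵥ w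
  have hw : w = γ.1 *ᵥ x := by
    have : γ.1 * (γ⁻¹).1 = 1 := congrArg Subtype.val (mul_inv_cancel γ)
    rw [mulVec_mulVec, this, one_mulVec]
  let x' : Fin (n + 2) → S.Zs := fun i ↦ x (Fin.natAdd 1 i)
  let t : S.Zs := x 0
  have hx : x = Fin.append (fun _ ↦ t) x' := by
    rw [← Fin.append_castAdd_natAdd (f := x)]
    congr 1
    ext i
    rw [Subsingleton.elim i 0]
    rfl
  have he : stdVec S.Zs (1 + (n + 2)) 0 = Fin.append (fun _ ↦ 1) 0 := by
    rw [stdVec_append_left one_pos]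
    congr 1
    ext i
    simp [stdVec]
  by_cases h0 : x' = 0
  · left
    refine ⟨t, ?_⟩
    rw [← mulVec_smul, hw, hx, he, h0]
    congr 1
    ext i
    refine Fin.addCases (fun i ↦ ?_) (fun i ↦ ?_) i <;> simp
  · right
    obtain ⟨m₀, hm₀, v, a, hv, hav⟩ := exists_unimodular h0
    obtain ⟨m, hm, u, rfl⟩ := exists_unit_mul hm₀
    obtain ⟨r, hr, b, hb⟩ := exists_residue hm t
    obtain ⟨D, hD⟩ := exists_SL_mulVec_eq (n := n + 2) (by omega)
      (v := (u : S.Zs) • v) (a := ((u⁻¹ : S.Zsˣ) : S.Zs) • a) (by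
        rw [dotProduct_smul, smul_dotProduct, smul_smul, hav]
        simp)
    let B : Matrix (Fin 1) (Fin (n + 2)) S.Zs := of fun _ j ↦ if j = 0 then b else 0
    have hB : B *ᵥ stdVec S.Zs (n + 2) 0 = fun _ ↦ b := by
      have := mulVec_stdVec B 0
      rw [Fin.val_zero] at this
      rw [this]
      ext i
      simp [B]
    have h1 : (γ * blockSL B D).1 *ᵥ stdVec S.Zs (1 + (n + 2)) 0 =
        γ.1 *ᵥ stdVec S.Zs (1 + (n + 2)) 0 := by
      change (γ.1 * (blockSL B D).1) *ᵥ _ = _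
      rw [← mulVec_mulVec, blockSL_mulVec_stdVec _ _ one_pos]
    refine ⟨m, hm, r, hr, γ * blockSL B D, h1, ?_⟩
    have h2 : (γ * blockSL B D).1 *ᵥ stdVec S.Zs (1 + (n + 2)) 1 =
        γ.1 *ᵥ Fin.append (fun _ ↦ b) ((u : S.Zs) • v) := by
      change (γ.1 * (blockSL B D).1) *ᵥ _ = _
      rw [← mulVec_mulVec, stdVec_append_right, blockSL_mulVec, hB, hD, zero_add]
    rw [h1, h2, ← mulVec_smul, ← mulVec_smul, ← mulVec_add, hw, hx, hv]
    congr 1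
    ext i
    refine Fin.addCases (fun i ↦ ?_) (fun i ↦ ?_) i
    · simp [he, hb]
    · simp [he]
      ring

lemma ratSMul_smul (q : ℚ) (g : S.G d) (x : S.QS d) :
    S.ratSMul q (g • x) = g • S.ratSMul q x := by
  ext
  · simp [ratSMul, mulVec, dotProduct, Finset.mul_sum, mul_left_comm]
  · simp [ratSMul, mulVec, dotProduct, Finset.mul_sum, mul_left_comm]

lemma dz_smul (q : S.Zs) (v : Fin d → S.Zs) : dz (q • v) = S.ratSMul q (dz v) := by
  ext <;> simp [dz, diag, ratSMul]

lemma continuous_ratSMul (q : ℚ) : Continuous (S.ratSMul q : S.QS d → S.QS d) := by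
  unfold ratSMul
  fun_prop

/-- Multiplication by a nonzero rational. -/
def ratSMulEquiv (S : PrimeTup) (d : ℕ) {q : ℚ} (hq : q ≠ 0) : S.QS d ≃+ S.QS d where
  toFun := S.ratSMul q
  invFun := S.ratSMul q⁻¹
  left_inv x := by
    ext
    · simp [ratSMul, hq]
    · simp [ratSMul, hq]
  right_inv x := by
    ext
    · simp [ratSMul, hq]
    · simp [ratSMul, hq]
  map_add' x y := by
    ext
    · simp [ratSMul, mul_add]
    · simp [ratSMul, mul_add]

lemma norm_natCast_NS {m : ℕ} (hm : m ∈ S.NS) (i : Fin S.s) : ‖(m : S.Qp i)‖ = 1 := by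
  rw [Padic.norm_natCast_eq_one_iff]
  exact ((Nat.Prime.coprime_iff_not_dvd (S.hp i)).2 (hm.2 i))

/-- The scaling of the volume under multiplication by an integer prime to `S`. -/
lemma vol_preimage_ratSMul {m : ℕ} (hm : m ∈ S.NS) {B : Set (S.QS d)} (hB : MeasurableSet B) :
    S.vol d (S.ratSMul m ⁻¹' B) = ((m : ℝ≥0∞) ^ d)⁻¹ * S.vol d B := by
  have hm0 : (m : ℚ) ≠ 0 := by exact_mod_cast hm.1.ne'
  have hmR : (0 : ℝ) < m := by exact_mod_cast hm.1
  let e := S.ratSMulEquiv d hm0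
  have : ((S.vol d).map e).IsAddHaarMeasure :=
    e.isAddHaarMeasure_map _ (continuous_ratSMul _) (continuous_ratSMul _)
  have hu : S.vol d (S.ratSMul m ⁻¹' S.unitBox d) = ((m : ℝ≥0∞) ^ d)⁻¹ := by
    have : S.ratSMul m ⁻¹' S.unitBox d =
        (Set.Icc 0 fun _ ↦ (m : ℝ)⁻¹) ×ˢ Set.univ.pi fun i ↦ S.boxp d i := by
      ext x
      simp only [unitBox, boxp, ratSMul, Set.mem_preimage, Set.mem_ofPred_eq, Set.mem_prod,
        Set.mem_Icc, Set.mem_pi, Pi.le_def, norm_mul, Rat.cast_natCast, norm_natCast_NS hm, one_mul]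
      have hle : ∀ t : ℝ, m * t ≤ 1 ↔ t ≤ (m : ℝ)⁻¹ := fun t ↦ by
        rw [inv_eq_one_div, le_div_iff₀' hmR]
      simp [forall_and, mul_nonneg_iff_of_pos_left hmR, hle]
    rw [this, vol_prod]
    simp [volp_boxp, Real.volume_Icc_pi, ENNReal.ofReal_inv_of_pos hmR, ENNReal.inv_pow]
  have h := Measure.isAddLeftInvariant_eq_smul ((S.vol d).map e) (S.vol d)
  have hmeas : Measurable e := (continuous_ratSMul _).measurable
  have hbox : MeasurableSet (S.unitBox d) := by
    rw [unitBox_eq]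
    exact measurableSet_Icc.prod
      (MeasurableSet.univ_pi fun i ↦ (isCompact_boxp i).measurableSet)
  have h4 := congrArg (fun m ↦ m (S.unitBox d)) h
  simp only [Measure.map_apply hmeas hbox, Measure.smul_apply, vol_unitBox] at h4
  have h5 := congrArg (fun m ↦ m B) h
  simp only [Measure.map_apply hmeas hB, Measure.smul_apply, ENNReal.smul_def, smul_eq_mul] at h5
  change S.vol d (e ⁻¹' B) = _
  rw [h5]
  congr 1
  change S.vol d (S.ratSMul m ⁻¹' S.unitBox d) = _ at h4
  rw [hu, ENNReal.smul_def, smul_eq_mul, mul_one] at h4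
  exact h4.symm

/-- The map `(x, y) ↦ (x, a x + m y)`. -/
def shear (S : PrimeTup) (d a m : ℕ) (y : Fin 2 → S.QS d) : Fin 2 → S.QS d :=
  ![y 0, S.ratSMul a (y 0) + S.ratSMul m (y 1)]

lemma shear_smul (a m : ℕ) (g : S.G d) (y : Fin 2 → S.QS d) :
    S.shear d a m (g • y) = g • S.shear d a m y := by
  ext1 i
  fin_cases i
  · rfl
  · change S.ratSMul a (g • y 0) + S.ratSMul m (g • y 1) =
      g • (S.ratSMul a (y 0) + S.ratSMul m (y 1))
    rw [smul_add, ratSMul_smul, ratSMul_smul]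

lemma measurable_shear (a m : ℕ) : Measurable (S.shear d a m) := by
  refine measurable_pi_lambda _ fun i ↦ ?_
  fin_cases i
  · exact measurable_pi_apply 0
  · have h0 : Measurable fun y : Fin 2 → S.QS d ↦ y 0 := measurable_pi_apply 0
    have h1 : Measurable fun y : Fin 2 → S.QS d ↦ y 1 := measurable_pi_apply 1
    exact ((continuous_ratSMul _).measurable.comp h0).add
      ((continuous_ratSMul _).measurable.comp h1)

lemma lintegral_volk_two {f : (Fin 2 → S.QS d) → ℝ≥0∞} (hf : Measurable f) :
    ∫⁻ y, f y ∂(S.volk d 2) = ∫⁻ x, ∫⁻ y, f ![x, y] ∂(S.vol d) ∂(S.vol d) := by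
  have h := (measurePreserving_finTwoArrow (S.vol d)).symm
  have h2 : ∫⁻ y, f y ∂(S.volk d 2) =
      ∫⁻ p, f (MeasurableEquiv.finTwoArrow.symm p) ∂((S.vol d).prod (S.vol d)) :=
    (h.lintegral_comp hf).symm
  rw [h2, lintegral_prod (fun p ↦ f (MeasurableEquiv.finTwoArrow.symm p)) (hf.comp (MeasurableEquiv.measurable _)).aemeasurable]
  rfl

lemma volk_preimage_shear (a : ℕ) {m : ℕ} (hm : m ∈ S.NS) {B : Set (Fin 2 → S.QS d)}
    (hB : MeasurableSet B) :
    S.volk d 2 (S.shear d a m ⁻¹' B) = ((m : ℝ≥0∞) ^ d)⁻¹ * S.volk d 2 B := by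
  have hB' := measurable_shear a m hB
  have hpair : ∀ x : S.QS d, Measurable fun y : S.QS d ↦ (![x, y] : Fin 2 → S.QS d) := fun x ↦ by
    refine measurable_pi_lambda _ fun i ↦ ?_
    fin_cases i
    · exact measurable_const
    · exact measurable_id
  rw [← lintegral_indicator_one hB', ← lintegral_indicator_one hB,
    lintegral_volk_two (measurable_one.indicator hB'),
    lintegral_volk_two (measurable_one.indicator hB), ← lintegral_const_mul']
  · refine lintegral_congr fun x ↦ ?_
    have h1 : ∀ C : Set (Fin 2 → S.QS d), MeasurableSet C →
        ∫⁻ y, C.indicator 1 ![x, y] ∂(S.vol d) = S.vol d ((fun y ↦ ![x, y]) ⁻¹' C) := by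
      intro C hC
      rw [← lintegral_indicator_one (hpair x hC)]
      rfl
    rw [h1 _ hB', h1 _ hB]
    have h2 : (fun y ↦ (![x, y] : Fin 2 → S.QS d)) ⁻¹' (S.shear d a m ⁻¹' B) =
        S.ratSMul m ⁻¹' ((fun y ↦ S.ratSMul a x + y) ⁻¹' ((fun y ↦ ![x, y]) ⁻¹' B)) := rfl
    rw [h2, vol_preimage_ratSMul hm (((hpair x hB).preimage (measurable_const_add _))),
      measure_preimage_add]
  · exact ENNReal.inv_ne_top.2 (pow_ne_zero _ (by exact_mod_cast hm.1.ne'))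

end PrimeTup

end

noncomputable section

namespace PrimeTup

variable {S : PrimeTup} {d k : ℕ}

lemma mem_prim_iff {y : S.QS d} :
    y ∈ S.prim d ↔ ∃ γ : SpecialLinearGroup (Fin d) S.Zs,
      S.toG d γ • dz (stdVec S.Zs d 0) = y := by
  constructor
  · rintro ⟨_, ⟨γ, rfl⟩, rfl⟩
    exact ⟨γ, toG_smul_dz γ _⟩
  · rintro ⟨γ, rfl⟩
    exact ⟨_, ⟨γ, rfl⟩, (toG_smul_dz γ _).symm⟩

instance : Countable (S.prim d) := by
  have : S.prim d ⊆ Set.range fun γ : SpecialLinearGroup (Fin d) S.Zs ↦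
      S.toG d γ • (dz (stdVec S.Zs d 0) : S.QS d) := fun y hy ↦ mem_prim_iff.1 hy
  exact ((Set.countable_range _).mono this).to_subtype

lemma smul_mem_prim (γ : S.G d) (hγ : γ ∈ S.Gamma d) (t : S.QS d) (ht : t ∈ S.prim d) :
    γ • t ∈ S.prim d := by
  obtain ⟨γ, rfl⟩ := hγ
  obtain ⟨δ, rfl⟩ := mem_prim_iff.1 ht
  exact mem_prim_iff.2 ⟨γ * δ, by rw [map_mul, mul_smul]⟩

lemma volk_one_preimage_eval (B : Set (S.QS d)) :
    S.volk d 1 ((fun y ↦ y 0) ⁻¹' B) = S.vol d B := by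
  have : ((fun y : Fin 1 → S.QS d ↦ y 0) ⁻¹' B) = Set.univ.pi fun _ ↦ B := by
    ext y
    simp [Set.mem_pi]
  rw [this, volk, Measure.pi_pi]
  simp

variable (μ : Measure (S.G d ⧸ S.Gamma d))

lemma siegelMeasure_prim_apply {B : Set (S.QS d)} (hB : MeasurableSet B) :
    siegelMeasure (S.prim d) μ B =
      siegelMeasure (S.primFrames d 1) μ ((fun y ↦ y 0) ⁻¹' B) := by
  have hB' : MeasurableSet ((fun y : Fin 1 → S.QS d ↦ y 0) ⁻¹' B) :=
    hB.preimage (measurable_pi_apply 0)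
  refine le_antisymm
    (siegelMeasure_le_of_lift smul_mem_prim smul_mem_primFrames μ hB hB' (fun y ↦ y 0) ?_)
    (siegelMeasure_le_of_lift smul_mem_primFrames smul_mem_prim μ hB' hB (fun t _ ↦ t) ?_)
  · rintro g _ ht h
    obtain ⟨γ, rfl⟩ := mem_prim_iff.1 ht
    exact ⟨_, ⟨γ, rfl⟩, rfl, h⟩
  · rintro g _ ⟨γ, rfl⟩ h
    refine ⟨_, mem_prim_iff.2 ⟨γ, rfl⟩, ?_, h⟩
    funext i
    rw [Subsingleton.elim i 0]
    rfl

lemma exists_siegelMeasure_prim_eq (hd : 1 < d) [IsFiniteMeasure μ]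
    [SMulInvariantMeasure (S.G d) (S.G d ⧸ S.Gamma d) μ] :
    ∃ c : ℝ≥0∞, c ≠ ∞ ∧ siegelMeasure (S.prim d) μ = c • S.vol d := by
  obtain ⟨c, hc, h⟩ := exists_siegelMeasure_primFrames_eq μ hd
  refine ⟨c, hc, Measure.ext fun B hB ↦ ?_⟩
  rw [siegelMeasure_prim_apply μ hB, h, Measure.smul_apply, Measure.smul_apply,
    volk_one_preimage_eval]

lemma one_le_siegelMeasure_prim_box (hd : 0 < d) [IsProbabilityMeasure μ] :
    1 ≤ siegelMeasure (S.prim d) μ (S.box d) := by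
  rw [siegelMeasure_apply smul_mem_prim μ isCompact_box.measurableSet, ← measure_univ (μ := μ),
    ← lintegral_one]
  refine lintegral_mono fun x ↦ ?_
  obtain ⟨u, -, hu⟩ := exists_fix_frame_smul_mem_box (S := S) (d := d) (k := 0) (g := x.out) hd
    (Subsingleton.elim _ _)
  refine le_trans ?_ (ENNReal.le_tsum (⟨_, mem_prim_iff.2 ⟨u, rfl⟩⟩ : S.prim d))
  rw [Set.indicator_of_mem hu]
  exact le_rfl

/-- Pairs of primitive vectors that are not proportional over `ℤ_S`. -/
def indPairs (S : PrimeTup) (d : ℕ) : Set (Fin 2 → S.QS d) :=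
  {y | y 0 ∈ S.prim d ∧ y 1 ∈ S.prim d ∧ ∀ q : S.Zs, y 1 ≠ S.ratSMul q (y 0)}

instance : Countable (S.indPairs d) := by
  refine Set.Countable.to_subtype (Set.Countable.mono ?_
    (Set.countable_pi (s := fun _ : Fin 2 ↦ S.prim d) fun _ ↦ Set.to_countable _))
  intro y hy i
  fin_cases i
  exacts [hy.1, hy.2.1]

lemma smul_mem_indPairs (γ : S.G d) (hγ : γ ∈ S.Gamma d) (t : Fin 2 → S.QS d)
    (ht : t ∈ S.indPairs d) : γ • t ∈ S.indPairs d := by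
  refine ⟨smul_mem_prim γ hγ _ ht.1, smul_mem_prim γ hγ _ ht.2.1, fun q hq ↦ ht.2.2 q ?_⟩
  change γ • t 1 = S.ratSMul q (γ • t 0) at hq
  rw [ratSMul_smul] at hq
  exact smul_left_cancel γ hq

lemma mem_indPairs_lift (hd : 3 ≤ d) {t : Fin 2 → S.QS d} (ht : t ∈ S.indPairs d) :
    ∃ m ∈ S.NS, ∃ a < m, ∃ y ∈ S.primFrames d 2, S.shear d a m y = t := by
  obtain ⟨γ, hγ⟩ := mem_prim_iff.1 ht.1
  obtain ⟨δ, hδ⟩ := mem_prim_iff.1 ht.2.1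
  have h2 := ht.2.2
  rw [toG_smul_dz] at hγ hδ
  rcases exists_pair_eq hd γ (δ.1 *ᵥ stdVec S.Zs d 0) with ⟨q, hq⟩ | ⟨m, hm, a, ha, ε, h0, h1⟩
  · refine absurd ?_ (h2 q)
    rw [← hγ, ← hδ, ← dz_smul]
    exact congrArg dz hq
  · refine ⟨m, hm, a, ha, _, ⟨ε, rfl⟩, ?_⟩
    have e0 : S.toG d ε • (dz (stdVec S.Zs d 0) : S.QS d) = t 0 := by
      rw [toG_smul_dz, ← hγ]
      exact congrArg dz h0
    funext i
    fin_cases i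
    · exact e0
    · change S.ratSMul a (S.toG d ε • dz (stdVec S.Zs d 0)) +
        S.ratSMul m (S.toG d ε • dz (stdVec S.Zs d 1)) = t 1
      rw [← hδ, h1, dz_add, dz_smul, dz_smul, toG_smul_dz, toG_smul_dz]
      simp

end PrimeTup

end

noncomputable section

namespace PrimeTup

variable {S : PrimeTup} {d k : ℕ}

lemma tsum_NS_ne_top (hd : 3 ≤ d) : ∑' i : Σ m : S.NS, Fin m, (((i.1 : ℕ) : ℝ≥0∞) ^ d)⁻¹ ≠ ∞ := by
  rw [ENNReal.tsum_sigma (fun (m : S.NS) (_ : Fin m) ↦ (((m : ℕ) : ℝ≥0∞) ^ d)⁻¹)]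
  simp only [tsum_fintype, Finset.sum_const, Finset.card_univ, Fintype.card_fin, nsmul_eq_mul]
  have hs : Summable fun m : ℕ ↦ 1 / (m : ℝ) ^ 2 := Real.summable_one_div_nat_pow.2 one_lt_two
  have h2 := hs.tsum_ofReal_ne_top
  refine ne_top_of_le_ne_top h2 (le_trans (ENNReal.tsum_le_tsum fun m : S.NS ↦ ?_)
    (ENNReal.tsum_comp_le_tsum_of_injective (f := ((↑) : S.NS → ℕ)) Subtype.val_injective _))
  have hm : (1 : ℝ) ≤ ((m : ℕ) : ℝ) := by exact_mod_cast m.2.1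
  rw [← ENNReal.ofReal_natCast, ← ENNReal.ofReal_pow (by positivity),
    ← ENNReal.ofReal_inv_of_pos (by positivity), ← ENNReal.ofReal_mul (by positivity)]
  refine ENNReal.ofReal_le_ofReal ?_
  obtain ⟨e, rfl⟩ := Nat.exists_eq_add_of_le hd
  rw [← div_eq_mul_inv, div_le_div_iff₀ (by positivity) (by positivity)]
  have : ((m : ℕ) : ℝ) ^ 3 ≤ ((m : ℕ) : ℝ) ^ (3 + e) := pow_le_pow_right₀ hm (by omega)
  linarith [this, pow_succ ((m : ℕ) : ℝ) 2]

variable (μ : Measure (S.G d ⧸ S.Gamma d))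

lemma siegelSum_indPairs_le (hd : 3 ≤ d) (B : Set (Fin 2 → S.QS d)) (x : S.G d ⧸ S.Gamma d) :
    siegelSum (S.Gamma d) (S.indPairs d) (B.indicator 1) x ≤
      ∑' i : Σ m : S.NS, Fin m,
        siegelSum (S.Gamma d) (S.primFrames d 2) ((S.shear d i.2 i.1 ⁻¹' B).indicator 1) x := by
  unfold siegelSum
  rw [tsum_subtype (S.indPairs d) (fun t ↦ B.indicator 1 (x.out • t)),
    ← ENNReal.tsum_prod (f := fun (i : Σ m : S.NS, Fin m) (t : S.primFrames d 2) ↦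
      (S.shear d i.2 i.1 ⁻¹' B).indicator (1 : (Fin 2 → S.QS d) → ℝ≥0∞)
        (x.out • (t : Fin 2 → S.QS d)))]
  refine ENNReal.tsum_le_tsum_of_lift _ _
    (fun p ↦ S.shear d p.1.2 p.1.1 (p.2 : Fin 2 → S.QS d)) fun t ht ↦ ?_
  have ht1 : t ∈ S.indPairs d := by
    by_contra hc
    simp [hc] at ht
  have ht2 : x.out • t ∈ B := by
    by_contra hc
    simp [hc, ht1] at ht
  obtain ⟨m, hm, a, ha, y, hy, rfl⟩ := mem_indPairs_lift hd ht1
  refine ⟨(⟨⟨m, hm⟩, ⟨a, ha⟩⟩, ⟨y, hy⟩), rfl, ?_⟩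
  have : x.out • y ∈ S.shear d a m ⁻¹' B := by
    rw [Set.mem_preimage, shear_smul]
    exact ht2
  rw [Set.indicator_of_mem ht1, Set.indicator_of_mem ht2, Set.indicator_of_mem this]
  exact le_rfl

/-- Siegel's mean value formula for pairs of independent primitive vectors, up to a constant. -/
lemma exists_siegelMeasure_indPairs_eq (hd : 3 ≤ d) [IsFiniteMeasure μ]
    [SMulInvariantMeasure (S.G d) (S.G d ⧸ S.Gamma d) μ] :
    ∃ c : ℝ≥0∞, c ≠ ∞ ∧ siegelMeasure (S.indPairs d) μ = c • S.volk d 2 := by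
  obtain ⟨c, hc, h⟩ := exists_siegelMeasure_primFrames_eq (k := 2) μ (by omega)
  set K := ∑' i : Σ m : S.NS, Fin m, (((i.1 : ℕ) : ℝ≥0∞) ^ d)⁻¹ with hK
  have hle : siegelMeasure (S.indPairs d) μ ≤ (c * K) • S.volk d 2 := by
    refine Measure.le_iff.2 fun B hB ↦ ?_
    have hmeas : ∀ i : Σ m : S.NS, Fin m, MeasurableSet (S.shear d i.2 i.1 ⁻¹' B) :=
      fun i ↦ measurable_shear _ _ hB
    calc siegelMeasure (S.indPairs d) μ B
        ≤ ∫⁻ x, ∑' i : Σ m : S.NS, Fin m, siegelSum (S.Gamma d) (S.primFrames d 2)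
            ((S.shear d i.2 i.1 ⁻¹' B).indicator 1) x ∂μ := by
          rw [siegelMeasure_apply smul_mem_indPairs μ hB]
          exact lintegral_mono fun x ↦ siegelSum_indPairs_le hd B x
      _ = ∑' i : Σ m : S.NS, Fin m,
            siegelMeasure (S.primFrames d 2) μ (S.shear d i.2 i.1 ⁻¹' B) := by
          rw [lintegral_tsum fun i ↦ (measurable_siegelSum smul_mem_primFrames
            (measurable_one.indicator (hmeas i))).aemeasurable]
          exact tsum_congr fun i ↦ (siegelMeasure_apply smul_mem_primFrames μ (hmeas i)).symm
      _ = ∑' i : Σ m : S.NS, Fin m, (((i.1 : ℕ) : ℝ≥0∞) ^ d)⁻¹ * (c * S.volk d 2 B) := by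
          refine tsum_congr fun i ↦ ?_
          rw [h, Measure.smul_apply, volk_preimage_shear _ i.1.2 hB, smul_eq_mul, mul_left_comm]
      _ = ((c * K) • S.volk d 2) B := by
          rw [ENNReal.tsum_mul_right, Measure.smul_apply, smul_eq_mul, ← hK]
          ring
  have hcK : c * K ≠ ∞ := ENNReal.mul_ne_top hc (tsum_NS_ne_top hd)
  have : SigmaFinite ((c * K) • S.volk d 2) := by
    lift c * K to NNReal using hcK with r
    exact inferInstanceAs (SigmaFinite (r • S.volk d 2))
  have := Measure.sigmaFinite_of_le _ hle
  have := smulInvariantMeasure_siegelMeasure (Γ := S.Gamma d) (smul_mem_indPairs (d := d)) μ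
  refine eq_smul_volk (by omega) _ (nonpos_iff_eq_zero.1 ((hle _).trans ?_))
  rw [Measure.smul_apply, volk_orbit_compl (by omega), smul_zero]

end PrimeTup

end

noncomputable section

namespace PrimeTup

variable {S : PrimeTup} {d k : ℕ}

/-- The denominator of an `S`-integer is bounded by its `p`-adic sizes, `p ∈ S_f`. -/
lemma den_le_prod {q : ℚ} (hq : q ∈ S.Zs) : (q.den : ℝ) ≤ ∏ i, max 1 ‖(q : S.Qp i)‖ := by
  have h1 : ∀ i, ∃ k : ℕ, max 1 ‖(q : S.Qp i)‖ = (S.p i : ℝ) ^ k := by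
    intro i
    rcases le_or_gt ‖(q : S.Qp i)‖ 1 with h | h
    · exact ⟨0, by rw [max_eq_left h, pow_zero]⟩
    · have hq0 : (q : S.Qp i) ≠ 0 := by
        rintro h0
        norm_num [h0] at h
      obtain ⟨n, hn⟩ : ∃ n : ℤ, ‖(q : S.Qp i)‖ = (S.p i : ℝ) ^ n :=
        ⟨_, Padic.norm_eq_zpow_neg_valuation hq0⟩
      have hp1 : (1 : ℝ) < S.p i := by exact_mod_cast (S.hp i).one_lt
      have hn0 : 0 ≤ n := by
        by_contra hc
        push Not at hc
        rw [hn] at h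
        exact absurd (zpow_lt_one_of_neg₀ hp1 hc) (not_lt.2 h.le)
      lift n to ℕ using hn0
      exact ⟨n, by rw [max_eq_right h.le, hn]; simp⟩
  choose k hk using h1
  have hden := den_mul_prod_eq_one hq k fun i ↦ (le_max_right _ _).trans (hk i).le
  set P : ℕ := ∏ i, S.p i ^ k i with hP
  have hP0 : 0 < P := Finset.prod_pos fun i _ ↦ pow_pos (S.hp i).pos _
  have hdvd : q.den ∣ P := by
    have hz : (((q * P).num : ℤ) : ℚ) = q * P := Rat.coe_int_num_of_den_eq_one hden
    have h2 : ((q.num * P : ℤ) : ℚ) = (((q * P).num * q.den : ℤ) : ℚ) := by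
      push_cast
      rw [hz]
      nth_rewrite 2 [← Rat.num_div_den q]
      have : (q.den : ℚ) ≠ 0 := by exact_mod_cast q.den_ne_zero
      field_simp
    have h3 : q.num * P = (q * P).num * q.den := by exact_mod_cast h2
    have h4 : (q.den : ℤ) ∣ q.num * P := ⟨_, h3.trans (mul_comm _ _)⟩
    have h5 : IsCoprime (q.den : ℤ) q.num := by
      rw [Int.isCoprime_iff_gcd_eq_one, Int.gcd_comm]
      exact q.reduced
    exact_mod_cast h5.dvd_of_dvd_mul_left h4
  calc (q.den : ℝ) ≤ P := by exact_mod_cast Nat.le_of_dvd hP0 hdvd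
    _ = ∏ i, max 1 ‖(q : S.Qp i)‖ := by
      rw [hP]
      push_cast
      exact Finset.prod_congr rfl fun i _ ↦ (hk i).symm

/-- The height `max (|num q|, den q)` of a rational number. -/
def height (q : ℚ) : ℝ := max 1 |(q : ℝ)| * q.den

lemma height_pos (q : ℚ) : 0 < height q :=
  mul_pos (lt_max_of_lt_left one_pos) (by exact_mod_cast q.den_pos)

lemma volume_inter_smul_le (A : Set (Fin d → ℝ)) (t : ℝ) :
    volume (A ∩ (fun x ↦ t • x) ⁻¹' A) ≤ ENNReal.ofReal ((max 1 |t|) ^ d)⁻¹ * volume A := by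
  rcases le_or_gt |t| 1 with h | h
  · rw [max_eq_left h]
    simpa using measure_mono Set.inter_subset_left
  · have ht : t ≠ 0 := by
      rintro rfl
      norm_num at h
    refine (measure_mono Set.inter_subset_right).trans_eq ?_
    rw [Measure.addHaar_preimage_smul volume ht, max_eq_right h.le]
    simp [abs_inv, abs_pow]

lemma volp_inter_smul_le {i : Fin S.s} (A : Set (Fin d → S.Qp i)) (t : S.Qp i) :
    S.volp d i (A ∩ (fun x ↦ t • x) ⁻¹' A) ≤
      ENNReal.ofReal ((max 1 ‖t‖) ^ d)⁻¹ * S.volp d i A := by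
  rcases le_or_gt ‖t‖ 1 with h | h
  · rw [max_eq_left h]
    simpa using measure_mono Set.inter_subset_left
  · have ht : t ≠ 0 := by
      rintro rfl
      norm_num at h
    have h1 : ‖t⁻¹‖ ≤ 1 := by
      rw [norm_inv]
      exact inv_le_one_of_one_le₀ h.le
    have hsub : A ∩ (fun x ↦ t • x) ⁻¹' A ⊆ (fun x ↦ t⁻¹ • x) '' A :=
      fun x hx ↦ ⟨t • x, hx.2, inv_smul_smul₀ ht x⟩
    refine (measure_mono hsub).trans ((volp_smul_le (inv_ne_zero ht) h1 A).trans_eq ?_)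
    rw [max_eq_right h.le, norm_inv, inv_pow]

lemma vol_inter_ratSMul_le (A : Set (Fin d → ℝ)) (B : (i : Fin S.s) → Set (Fin d → S.Qp i))
    {q : ℚ} (hq : q ∈ S.Zs) :
    S.vol d ((A ×ˢ Set.univ.pi B) ∩ S.ratSMul q ⁻¹' (A ×ˢ Set.univ.pi B)) ≤
      ENNReal.ofReal (height q ^ d)⁻¹ * S.vol d (A ×ˢ Set.univ.pi B) := by
  have hsub : (A ×ˢ Set.univ.pi B) ∩ S.ratSMul q ⁻¹' (A ×ˢ Set.univ.pi B) ⊆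
      (A ∩ (fun x ↦ (q : ℝ) • x) ⁻¹' A) ×ˢ
        Set.univ.pi fun i ↦ B i ∩ (fun x ↦ (q : S.Qp i) • x) ⁻¹' B i := by
    rintro x ⟨⟨h1, h2⟩, h3, h4⟩
    exact ⟨⟨h1, h3⟩, fun i hi ↦ ⟨h2 i hi, h4 i hi⟩⟩
  refine (measure_mono hsub).trans ?_
  rw [vol_prod, vol_prod]
  refine (mul_le_mul' (volume_inter_smul_le A _)
    (Finset.prod_le_prod' fun i _ ↦ volp_inter_smul_le (B i) _)).trans ?_
  rw [Finset.prod_mul_distrib, ← ENNReal.ofReal_prod_of_nonneg fun i _ ↦ by positivity,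
    mul_mul_mul_comm, ← ENNReal.ofReal_mul (by positivity)]
  gcongr
  rw [Finset.prod_inv_distrib, Finset.prod_pow, ← mul_inv, ← mul_pow]
  have := height_pos q
  gcongr
  exact mul_le_mul_of_nonneg_left (den_le_prod hq) (by positivity)

lemma tsum_height_ne_top (hd : 3 ≤ d) :
    ∑' q : S.Zs, ENNReal.ofReal (height (q : ℚ) ^ d)⁻¹ ≠ ∞ := by
  have hb : (1 : ℝ) < 3 / 2 := by norm_num
  have h1 : Summable fun n : ℤ ↦ (max 1 |(n : ℝ)|) ^ (-(3 / 2) : ℝ) := by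
    refine (Real.summable_abs_int_rpow hb).congr_cofinite ?_
    filter_upwards [(Set.finite_singleton (0 : ℤ)).compl_mem_cofinite] with n hn
    have : (1 : ℝ) ≤ |(n : ℝ)| := by exact_mod_cast Int.one_le_abs hn
    rw [max_eq_right this]
  have h2 : Summable fun n : ℕ ↦ (n : ℝ) ^ (-(3 / 2) : ℝ) :=
    Real.summable_nat_rpow.2 (by norm_num)
  have h3 := (h1.mul_of_nonneg h2 (fun n ↦ by positivity) (fun n ↦ by positivity)).tsum_ofReal_ne_top
  have hinj : Function.Injective fun q : S.Zs ↦ ((q : ℚ).num, (q : ℚ).den) := fun q r h ↦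
    Subtype.ext (Rat.ext (congrArg Prod.fst h) (congrArg Prod.snd h))
  refine ne_top_of_le_ne_top h3 (le_trans (ENNReal.tsum_le_tsum fun q ↦ ?_)
    (ENNReal.tsum_comp_le_tsum_of_injective hinj _))
  refine ENNReal.ofReal_le_ofReal ?_
  have hden : (1 : ℝ) ≤ (q : ℚ).den := by exact_mod_cast (q : ℚ).den_pos
  have hnum : max 1 |((q : ℚ).num : ℝ)| ≤ height q := by
    have h : |((q : ℚ) : ℝ)| * (q : ℚ).den = |((q : ℚ).num : ℝ)| := by
      rw [← Nat.abs_cast, ← abs_mul]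
      exact_mod_cast congrArg (fun r : ℚ ↦ |r|) (Rat.mul_den_eq_num (q : ℚ))
    rw [height, max_mul_of_nonneg _ _ (by positivity), h]
    exact max_le_max (by simpa using hden) le_rfl
  have hden' : ((q : ℚ).den : ℝ) ≤ height q := le_mul_of_one_le_left (by positivity) (le_max_left _ _)
  have hh := height_pos (q : ℚ)
  have hh1 : 1 ≤ height q := hden.trans hden'
  calc (height q ^ d)⁻¹ ≤ (height q ^ 3)⁻¹ := by gcongr
    _ = height q ^ (-(3 / 2) : ℝ) * height q ^ (-(3 / 2) : ℝ) := by
      rw [← Real.rpow_add hh, ← Real.rpow_natCast, ← Real.rpow_neg hh.le]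
      norm_num
    _ ≤ _ := mul_le_mul
      (Real.rpow_le_rpow_of_nonpos (by positivity) hnum (by norm_num))
      (Real.rpow_le_rpow_of_nonpos (by positivity) hden' (by norm_num))
      (by positivity) (by positivity)

end PrimeTup

end

lemma ENNReal.tsum_le_tsum_add_tsum_of_lift {α β γ : Type*} (F : α → ℝ≥0∞) (H : β → ℝ≥0∞)
    (K : γ → ℝ≥0∞) (π : β → α) (ρ : γ → α)
    (h : ∀ a, F a ≠ 0 → (∃ b, π b = a ∧ F a ≤ H b) ∨ ∃ c, ρ c = a ∧ F a ≤ K c) :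
    ∑' a, F a ≤ ∑' b, H b + ∑' c, K c := by
  classical
  let s : Set α := {a | ∃ b, π b = a ∧ F a ≤ H b}
  have hs : ∀ a, F a = s.indicator F a + sᶜ.indicator F a := fun a ↦
    (Set.indicator_self_add_compl_apply s F a).symm
  rw [tsum_congr hs, ENNReal.tsum_add]
  refine add_le_add (ENNReal.tsum_le_tsum_of_lift _ _ π fun a ha ↦ ?_)
    (ENNReal.tsum_le_tsum_of_lift _ _ ρ fun a ha ↦ ?_)
  · have has := Set.mem_of_indicator_ne_zero ha
    rw [Set.indicator_of_mem has] at ha ⊢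
    exact has
  · have has := Set.mem_of_indicator_ne_zero ha
    rw [Set.indicator_of_mem has] at ha ⊢
    exact (h a ha).resolve_left has

noncomputable section

namespace PrimeTup

variable {S : PrimeTup} {d k : ℕ}

/-- The pairs of vectors with first entry in `A` and second entry in `B`. -/
def pairSet (A B : Set (S.QS d)) : Set (Fin 2 → S.QS d) := {y | y 0 ∈ A ∧ y 1 ∈ B}

lemma pairSet_eq_pi (A B : Set (S.QS d)) : pairSet A B = Set.univ.pi ![A, B] := by
  ext y
  simp [pairSet, Set.mem_pi, Fin.forall_fin_two]

lemma measurableSet_pairSet {A B : Set (S.QS d)} (hA : MeasurableSet A) (hB : MeasurableSet B) :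
    MeasurableSet (pairSet A B) := by
  rw [pairSet_eq_pi]
  refine MeasurableSet.univ_pi fun i ↦ ?_
  fin_cases i
  exacts [hA, hB]

lemma volk_pairSet (A B : Set (S.QS d)) : S.volk d 2 (pairSet A B) = S.vol d A * S.vol d B := by
  rw [pairSet_eq_pi, volk, Measure.pi_pi, Fin.prod_univ_two]
  rfl

/-- The number of primitive vectors of the lattice `x` lying in `A`. -/
abbrev primCount (A : Set (S.QS d)) : S.G d ⧸ S.Gamma d → ℝ≥0∞ :=
  siegelSum (S.Gamma d) (S.prim d) (A.indicator 1)

lemma primCount_mul_eq (A B : Set (S.QS d)) (x : S.G d ⧸ S.Gamma d) :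
    primCount A x * primCount B x = ∑' p : S.QS d × S.QS d,
      (S.prim d ∩ (fun y ↦ x.out • y) ⁻¹' A).indicator 1 p.1 *
        (S.prim d ∩ (fun y ↦ x.out • y) ⁻¹' B).indicator 1 p.2 := by
  have h : ∀ A : Set (S.QS d), primCount A x =
      ∑' y, (S.prim d ∩ (fun y ↦ x.out • y) ⁻¹' A).indicator 1 y := by
    intro A
    rw [primCount, siegelSum, tsum_subtype (S.prim d) (fun t ↦ A.indicator 1 (x.out • t))]
    refine tsum_congr fun y ↦ ?_
    rw [← Set.indicator_indicator]
    rfl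
  rw [h A, h B, ENNReal.tsum_prod (f := fun y z ↦
    (S.prim d ∩ (fun y ↦ x.out • y) ⁻¹' A).indicator (1 : S.QS d → ℝ≥0∞) y *
        (S.prim d ∩ (fun y ↦ x.out • y) ⁻¹' B).indicator (1 : S.QS d → ℝ≥0∞) z),
    ← ENNReal.tsum_mul_right]
  simp_rw [ENNReal.tsum_mul_left]

lemma siegelSum_indPairs_le_primCount_mul (A B : Set (S.QS d)) (x : S.G d ⧸ S.Gamma d) :
    siegelSum (S.Gamma d) (S.indPairs d) ((pairSet A B).indicator 1) x ≤
      primCount A x * primCount B x := by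
  rw [primCount_mul_eq, siegelSum,
    tsum_subtype (S.indPairs d) (fun t ↦ (pairSet A B).indicator 1 (x.out • t))]
  refine ENNReal.tsum_le_tsum_of_lift _ _ (fun p ↦ ![p.1, p.2]) fun t ht ↦ ?_
  have ht1 : t ∈ S.indPairs d := by
    by_contra hc
    simp [hc] at ht
  have ht2 : x.out • t ∈ pairSet A B := by
    by_contra hc
    simp [hc, ht1] at ht
  refine ⟨(t 0, t 1), ?_, ?_⟩
  · ext1 i
    fin_cases i <;> rfl
  · have h0 : t 0 ∈ S.prim d ∩ (fun y ↦ x.out • y) ⁻¹' A := ⟨ht1.1, ht2.1⟩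
    have h1 : t 1 ∈ S.prim d ∩ (fun y ↦ x.out • y) ⁻¹' B := ⟨ht1.2.1, ht2.2⟩
    rw [Set.indicator_of_mem ht1, Set.indicator_of_mem ht2, Set.indicator_of_mem h0,
      Set.indicator_of_mem h1]
    simp

lemma primCount_sq_le (A : Set (S.QS d)) (x : S.G d ⧸ S.Gamma d) :
    primCount A x ^ 2 ≤ siegelSum (S.Gamma d) (S.indPairs d) ((pairSet A A).indicator 1) x +
      ∑' q : S.Zs, primCount (A ∩ S.ratSMul q ⁻¹' A) x := by
  rw [sq, primCount_mul_eq]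
  unfold primCount siegelSum
  rw [← ENNReal.tsum_prod (f := fun (q : S.Zs) (t : S.prim d) ↦
      (A ∩ S.ratSMul q ⁻¹' A).indicator (1 : S.QS d → ℝ≥0∞) (x.out • (t : S.QS d)))]
  refine ENNReal.tsum_le_tsum_add_tsum_of_lift _ _ _
    (fun y : S.indPairs d ↦ ((y : Fin 2 → S.QS d) 0, (y : Fin 2 → S.QS d) 1))
    (fun z : S.Zs × S.prim d ↦ ((z.2 : S.QS d), S.ratSMul z.1 (z.2 : S.QS d))) ?_
  rintro ⟨s, t⟩ hst
  have hs : s ∈ S.prim d ∩ (fun y ↦ x.out • y) ⁻¹' A := by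
    by_contra hc
    simp [hc] at hst
  have ht : t ∈ S.prim d ∩ (fun y ↦ x.out • y) ⁻¹' A := by
    by_contra hc
    simp [hc] at hst
  rw [Set.indicator_of_mem hs, Set.indicator_of_mem ht]
  by_cases h : ∃ q : S.Zs, t = S.ratSMul q s
  · obtain ⟨q, rfl⟩ := h
    refine Or.inr ⟨(q, ⟨s, hs.1⟩), rfl, ?_⟩
    have hmem : x.out • s ∈ A ∩ S.ratSMul q ⁻¹' A :=
      ⟨hs.2, by rw [Set.mem_preimage, ratSMul_smul]; exact ht.2⟩
    rw [Set.indicator_of_mem hmem]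
    simp
  · push Not at h
    refine Or.inl ⟨⟨![s, t], hs.1, ht.1, h⟩, rfl, ?_⟩
    have hmem : x.out • (![s, t] : Fin 2 → S.QS d) ∈ pairSet A A := ⟨hs.2, ht.2⟩
    rw [Set.indicator_of_mem hmem]
    simp

lemma measurable_primCount {A : Set (S.QS d)} (hA : MeasurableSet A) :
    Measurable (primCount A) :=
  measurable_siegelSum smul_mem_prim (measurable_one.indicator hA)

lemma primCount_smul (A : Set (S.QS d)) (g : S.G d) (x : S.G d ⧸ S.Gamma d) :
    primCount A (g • x) = primCount ((fun y ↦ g • y) ⁻¹' A) x :=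
  siegelSum_smul smul_mem_prim _ g x

/-- Lattices avoiding a product set of finite volume with all their primitive vectors have small
measure. -/
lemma measure_primCount_eq_zero_mul_le (hd : 3 ≤ d) (μ : Measure (S.G d ⧸ S.Gamma d))
    [IsProbabilityMeasure μ] [SMulInvariantMeasure (S.G d) (S.G d ⧸ S.Gamma d) μ]
    {A : Set (Fin d → ℝ)} (hA : MeasurableSet A) {B : (i : Fin S.s) → Set (Fin d → S.Qp i)}
    (hB : ∀ i, MeasurableSet (B i)) (hfin : S.vol d (A ×ˢ Set.univ.pi B) ≠ ∞) :
    μ {x | primCount (A ×ˢ Set.univ.pi B) x = 0} * S.vol d (A ×ˢ Set.univ.pi B) ≤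
      (∑' q : S.Zs, ENNReal.ofReal (height (q : ℚ) ^ d)⁻¹) * S.vol d (S.box d) := by
  obtain ⟨c, hc, h1⟩ := exists_siegelMeasure_prim_eq μ (by omega)
  obtain ⟨c₂, hc₂, h2⟩ := exists_siegelMeasure_indPairs_eq μ hd
  have hbox := one_le_siegelMeasure_prim_box μ (by omega)
  rw [h1, Measure.smul_apply, smul_eq_mul] at hbox
  set E : Set (S.QS d) := A ×ˢ Set.univ.pi B with hE
  set Z := ∑' q : S.Zs, ENNReal.ofReal (height (q : ℚ) ^ d)⁻¹ with hZ
  set V := S.vol d E with hV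
  have hEm : MeasurableSet E := hA.prod (MeasurableSet.univ_pi hB)
  have hcount : ∀ D : Set (S.QS d), MeasurableSet D →
      ∫⁻ x, primCount D x ∂μ = c * S.vol d D := fun D hD ↦ by
    rw [← siegelMeasure_apply smul_mem_prim μ hD, h1, Measure.smul_apply, smul_eq_mul]
  have hpair : ∀ D, MeasurableSet D → S.vol d D = V →
      ∫⁻ x, siegelSum (S.Gamma d) (S.indPairs d) ((pairSet E D).indicator 1) x ∂μ =
        c₂ * V ^ 2 := fun D hD hDV ↦ by
    rw [← siegelMeasure_apply smul_mem_indPairs μ (measurableSet_pairSet hEm hD), h2,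
      Measure.smul_apply, smul_eq_mul, volk_pairSet, hDV, sq]
  have hinter : ∀ q : S.Zs, MeasurableSet (E ∩ S.ratSMul q ⁻¹' E) := fun q ↦
    hEm.inter ((continuous_ratSMul _).measurable hEm)
  have hsq : ∫⁻ x, primCount E x ^ 2 ∂μ ≤ c₂ * V ^ 2 + c * (Z * V) := by
    refine (lintegral_mono fun x ↦ primCount_sq_le E x).trans ?_
    rw [lintegral_add_left (measurable_siegelSum smul_mem_indPairs
      (measurable_one.indicator (measurableSet_pairSet hEm hEm))), hpair E hEm rfl,
      lintegral_tsum fun q ↦ (measurable_primCount (hinter q)).aemeasurable]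
    gcongr
    rw [hZ, ← ENNReal.tsum_mul_right, ← ENNReal.tsum_mul_left]
    refine ENNReal.tsum_le_tsum fun q ↦ ?_
    rw [hcount _ (hinter q)]
    gcongr
    exact vol_inter_ratSMul_le A B q.2
  have hε : c * (Z * V) ≠ ∞ := ENNReal.mul_ne_top hc (ENNReal.mul_ne_top (tsum_height_ne_top hd) hfin)
  have key := measure_eq_zero_mul_sq_le (G := S.G d) (measurable_primCount hEm)
    (ne_top_of_le_ne_top (ENNReal.add_ne_top.2
      ⟨ENNReal.mul_ne_top hc₂ (ENNReal.pow_ne_top hfin), hε⟩) hsq) hε fun g ↦ by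
      refine hsq.trans (add_le_add_left ?_ _)
      have hgm : MeasurableSet ((fun y : S.QS d ↦ g • y) ⁻¹' E) := measurable_const_smul g hEm
      rw [← hpair _ hgm (measure_preimage_smul_of_nullMeasurableSet hEm.nullMeasurableSet g)]
      refine lintegral_mono fun x ↦ ?_
      rw [primCount_smul]
      exact siegelSum_indPairs_le_primCount_mul _ _ x
  rw [hcount E hEm] at key
  rcases eq_or_ne V 0 with hV0 | hV0
  · simp [hV0]
  have hc0 : c ≠ 0 := by
    rintro rfl
    simp at hbox
  set m := μ {x | primCount E x = 0}
  have hcV0 : c * V ≠ 0 := mul_ne_zero hc0 hV0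
  have hcV : c * V ≠ ∞ := ENNReal.mul_ne_top hc hfin
  have key2 : m * (c * V) ≤ Z := by
    rw [← ENNReal.mul_le_mul_iff_left hcV0 hcV]
    calc m * (c * V) * (c * V) = m * (c * V) ^ 2 := by ring
      _ ≤ c * (Z * V) := key
      _ = Z * (c * V) := by ring
  calc m * V ≤ m * V * (c * S.vol d (S.box d)) := le_mul_of_one_le_right' hbox
    _ = m * (c * V) * S.vol d (S.box d) := by ring
    _ ≤ Z * S.vol d (S.box d) := by gcongr

end PrimeTup

end

open PrimeTup in
/-- **Random Minkowski theorem, `d ≥ 3`** (Proposition 1.9).  There is `C' > 0`, depending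
only on `d` and `S`, such that for every product measurable set `A ⊆ ℚ_S^d` of positive
volume and every admissible `μ`,
`μ({gΓ : g(ℤ_S^d∖{0}) ∩ A = ∅}) ≤ μ({gΓ : g·P(ℤ_S^d) ∩ A = ∅}) ≤ C'/vol_S(A)`. -/
theorem random_minkowski
    (S : PrimeTup) (d : ℕ) (hd : 3 ≤ d) :
    ∃ C' : ℝ, 0 < C' ∧
      ∀ (volS : Measure (S.QS d)), S.IsVolS d volS →
      ∀ (Ainf : Set (Fin d → ℝ)), MeasurableSet Ainf →
      ∀ (Ap : (i : Fin S.s) → Set (Fin d → S.Qp i)), (∀ i, MeasurableSet (Ap i)) →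
      ∀ (A : Set (S.QS d)), A = {x | x.1 ∈ Ainf ∧ ∀ i, x.2 i ∈ Ap i} → 0 < volS A →
      ∀ (μ : Measure (S.G d ⧸ S.Gamma d)), S.Admissible d μ →
        μ {x : S.G d ⧸ S.Gamma d | ∀ g : S.G d, QuotientGroup.mk g = x →
            ∀ v : Fin d → S.Zs, v ≠ 0 → S.act g (S.diag fun j => ((v j : ℚ))) ∉ A} ≤
          μ {x : S.G d ⧸ S.Gamma d | ∀ g : S.G d, QuotientGroup.mk g = x →
            ∀ y ∈ S.prim d, S.act g y ∉ A} ∧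
        μ {x : S.G d ⧸ S.Gamma d | ∀ g : S.G d, QuotientGroup.mk g = x →
            ∀ y ∈ S.prim d, S.act g y ∉ A} ≤
          ENNReal.ofReal C' / volS A := by
  have hKtop : (∑' q : S.Zs, ENNReal.ofReal (height (q : ℚ) ^ d)⁻¹) * S.vol d (S.box d) ≠ ∞ :=
    ENNReal.mul_ne_top (tsum_height_ne_top hd) isCompact_box.measure_lt_top.ne
  set K := (∑' q : S.Zs, ENNReal.ofReal (height (q : ℚ) ^ d)⁻¹) * S.vol d (S.box d) with hK
  refine ⟨K.toReal + 1, by positivity, ?_⟩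
  rintro volS hvol Ainf hAinf Ap hAp A rfl hpos μ ⟨hμ1, -, hμ2⟩
  obtain rfl := hvol.eq_vol
  have hprim : ∀ y ∈ S.prim d, ∃ v : Fin d → S.Zs, v ≠ 0 ∧ (S.diag fun j ↦ (v j : ℚ)) = y := by
    rintro _ ⟨_, ⟨γ, rfl⟩, rfl⟩
    refine ⟨_, fun h0 ↦ ?_, rfl⟩
    have h1 : S.e1 d = 0 := by
      have hinv : (γ⁻¹).1 * γ.1 = 1 := congrArg Subtype.val (inv_mul_cancel γ)
      rw [← one_mulVec (S.e1 d), ← hinv, ← mulVec_mulVec, h0, mulVec_zero]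
    have := congrFun h1 ⟨0, by omega⟩
    simp [e1] at this
  refine ⟨measure_mono fun x hx g hg y hy ↦ ?_, ?_⟩
  · obtain ⟨v, hv, rfl⟩ := hprim y hy
    exact hx g hg v hv
  have hA : {x : S.QS d | x.1 ∈ Ainf ∧ ∀ i, x.2 i ∈ Ap i} = Ainf ×ˢ Set.univ.pi Ap := by
    ext x
    simp [Set.mem_pi]
  rw [hA] at hpos ⊢
  set M := μ {x : S.G d ⧸ S.Gamma d | ∀ g : S.G d, QuotientGroup.mk g = x →
    ∀ y ∈ S.prim d, S.act g y ∉ Ainf ×ˢ Set.univ.pi Ap}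
  let E : ℕ → Set (S.QS d) := fun n ↦ (Ainf ∩ Metric.closedBall 0 n) ×ˢ
    Set.univ.pi fun i ↦ Ap i ∩ Metric.closedBall 0 n
  have hEA : ∀ n, E n ⊆ Ainf ×ˢ Set.univ.pi Ap := fun n x hx ↦
    ⟨hx.1.1, fun i hi ↦ (hx.2 i hi).1⟩
  have hE : ∀ n, M * S.vol d (E n) ≤ K := by
    intro n
    refine le_trans ?_ (measure_primCount_eq_zero_mul_le hd μ
      (hAinf.inter Metric.isClosed_closedBall.measurableSet)
      (fun i ↦ (hAp i).inter Metric.isClosed_closedBall.measurableSet)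
      (ne_top_of_le_ne_top (b := S.vol d
        (Metric.closedBall 0 (n : ℝ) ×ˢ Set.univ.pi fun i ↦ Metric.closedBall 0 (n : ℝ))) ?_
        (measure_mono (Set.prod_mono Set.inter_subset_right
          (Set.pi_mono fun i _ ↦ Set.inter_subset_right)))))
    · gcongr
      refine measure_mono fun x hx ↦ ?_
      refine ENNReal.tsum_eq_zero.2 fun t ↦ Set.indicator_of_notMem (fun hc ↦ ?_) _
      exact hx x.out (Quotient.out_eq' x) t t.2 (hEA n hc)
    · exact ((isCompact_closedBall _ _).prod
        (isCompact_univ_pi fun i ↦ isCompact_closedBall _ _)).measure_lt_top.ne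
  have hmono : Monotone E := fun m n hmn ↦ by
    have h : (m : ℝ) ≤ n := by exact_mod_cast hmn
    exact Set.prod_mono (Set.inter_subset_inter_right _ (Metric.closedBall_subset_closedBall h))
      (Set.pi_mono fun i _ ↦ Set.inter_subset_inter_right _ (Metric.closedBall_subset_closedBall h))
  have hunion : Ainf ×ˢ Set.univ.pi Ap = ⋃ n, E n := by
    refine subset_antisymm (fun x hx ↦ ?_) (Set.iUnion_subset hEA)
    obtain ⟨n, hn⟩ := exists_nat_ge (‖x.1‖ + ∑ i, ‖x.2 i‖)
    have hsum : 0 ≤ ∑ i, ‖x.2 i‖ := Finset.sum_nonneg fun i _ ↦ norm_nonneg _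
    refine Set.mem_iUnion.2 ⟨n, ⟨hx.1, ?_⟩, fun i hi ↦ ⟨hx.2 i hi, ?_⟩⟩
    · rw [mem_closedBall_zero_iff]
      linarith
    · rw [mem_closedBall_zero_iff]
      have := Finset.single_le_sum (f := fun i ↦ ‖x.2 i‖) (fun i _ ↦ norm_nonneg _)
        (Finset.mem_univ i)
      linarith [norm_nonneg x.1]
  have hle : M * S.vol d (Ainf ×ˢ Set.univ.pi Ap) ≤ K := by
    rw [hunion, hmono.measure_iUnion, ENNReal.mul_iSup]
    exact iSup_le hE
  have hK' : K ≤ ENNReal.ofReal (K.toReal + 1) := by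
    rw [← ENNReal.ofReal_toReal hKtop, ENNReal.toReal_ofReal ENNReal.toReal_nonneg]
    exact ENNReal.ofReal_le_ofReal (by linarith)
  rw [ENNReal.le_div_iff_mul_le (Or.inl hpos.ne') (Or.inr ENNReal.ofReal_ne_top)]
  exact hle.trans hK'
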